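/- arXiv:1903.03901 — 8 statements merged into one kernel-verified Lean document; each statement's English description precedes it below -/
import Mathlib

section
/- Let F be a finite field of odd cardinality, let λ be the quadratic character of F (the unique multiplicative character of F of order 2, extended by λ(0) = 0), and let ψ be a nontrivial additive character of F with values in ℂ. Define S_F(λ, ψ) = Σ_{x ∈ F} Σ_{z ∈ F} λ(x³ + z)·ψ(z). Then: (1) if |F| ≡ 2 (mod 3), S_F(λ, ψ) = 0; (2) if |F| ≡ 1 (mod 3), S_F(λ, ψ) = G_F(λ, ψ)·(G_F(χ, ψ) + G_F(χ², ψ)), where χ is either of the two multiplicative characters of F of order exactly 3. -/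
namespace MulChar

variable {F R : Type*} [Field F] [Fintype F] [CommRing R] [IsDomain R]

/-- On a finite field, an element is a nonzero `n`-th power as soon as some multiplicative
character of order `n` takes the value `1` on it. -/
lemma exists_pow_orderOf_eq {χ : MulChar F R} {a : F} (ha : χ a = 1) :
    ∃ x : F, x ^ orderOf χ = a := by
  have ha0 : a ≠ 0 := by
    rintro rfl
    simp at ha
  obtain ⟨g, hg⟩ := IsCyclic.exists_generator (α := Fˣ)
  obtain ⟨k, hk⟩ := Submonoid.mem_powers_iff _ _ |>.mp
    (mem_powers_iff_mem_zpowers.mpr (hg (Units.mk0 a ha0)))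
  have hχg : orderOf χ ∣ orderOf (χ g) := by
    refine orderOf_dvd_of_pow_eq_one ((MulChar.eq_iff hg _ _).mpr ?_)
    rw [pow_apply_coe, pow_orderOf_eq_one, one_apply_coe]
  have hka : (g : F) ^ k = a := by simpa using congrArg Units.val hk
  have hpow : (χ g) ^ k = 1 := by rw [← map_pow, hka, ha]
  obtain ⟨m, rfl⟩ := hχg.trans (orderOf_dvd_of_pow_eq_one hpow)
  exact ⟨(g : F) ^ m, by rw [← hka, ← pow_mul, mul_comm]⟩

/-- The number of `n`-th roots of an element of a finite field, in terms of a multiplicative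
character of order `n`. -/
lemma card_pow_orderOf_eq [DecidableEq F] (χ : MulChar F R) (a : F) :
    (({x : F | x ^ orderOf χ = a} : Finset F).card : R) =
      ∑ i ∈ Finset.range (orderOf χ), χ a ^ i := by
  have hn : 0 < orderOf χ := χ.orderOf_pos
  rcases eq_or_ne a 0 with rfl | ha
  · obtain ⟨m, hm⟩ := Nat.exists_eq_succ_of_ne_zero hn.ne'
    simp [hm, Finset.sum_range_succ', Finset.filter_eq']
  have hroot : χ a ^ orderOf χ = 1 := by
    rw [← pow_apply' χ hn.ne', pow_orderOf_eq_one, one_apply ha.isUnit]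
  by_cases h1 : χ a = 1
  · obtain ⟨g, hg⟩ := IsCyclic.exists_ofOrder_eq_natCard (α := Fˣ)
    have hdvd : orderOf χ ∣ orderOf g := by
      rw [hg, Nat.card_eq_fintype_card, Fintype.card_units]
      exact χ.orderOf_dvd_card_sub_one
    obtain ⟨m, hm⟩ := hdvd
    have hζ : IsPrimitiveRoot ((g ^ m : Fˣ) : F) (orderOf χ) :=
      IsPrimitiveRoot.coe_units_iff.mpr <|
        (IsPrimitiveRoot.orderOf g).pow (_root_.orderOf_pos g) (by rw [hm, mul_comm])
    have hset : ({x : F | x ^ orderOf χ = a} : Finset F) =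
        (Polynomial.nthRoots (orderOf χ) a).toFinset := by
      ext x
      simp [Polynomial.mem_nthRoots hn]
    rw [hset, Multiset.toFinset_card_of_nodup (hζ.nthRoots_nodup ha), hζ.card_nthRoots,
      if_pos (exists_pow_orderOf_eq h1)]
    simp [h1]
  · have hempty : ({x : F | x ^ orderOf χ = a} : Finset F) = ∅ := by
      refine Finset.filter_eq_empty_iff.mpr fun x _ hx ↦ h1 ?_
      have hx0 : x ≠ 0 := by
        rintro rfl
        exact ha (by rw [← hx, zero_pow hn.ne'])
      rw [← hx, map_pow, ← pow_apply' χ hn.ne', pow_orderOf_eq_one, one_apply hx0.isUnit]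
    rw [hempty, Finset.card_empty, Nat.cast_zero]
    refine (mul_left_injective₀ (sub_ne_zero.mpr h1) ?_).symm
    simp only [geom_sum_mul, hroot, sub_self, zero_mul]

/-- A sum of additive character values over `n`-th powers is a sum of Gauss sums. -/
lemma sum_addChar_pow_orderOf (χ : MulChar F R) {ψ : AddChar F R} (hψ : ψ ≠ 1) :
    ∑ x : F, ψ (x ^ orderOf χ) =
      ∑ i ∈ (Finset.range (orderOf χ)).erase 0, gaussSum (χ ^ i) ψ := by
  have := Classical.decEq F
  have hn : 0 < orderOf χ := χ.orderOf_pos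
  calc ∑ x : F, ψ (x ^ orderOf χ)
      = ∑ a : F, (({x : F | x ^ orderOf χ = a} : Finset F).card : R) * ψ a := by
        rw [← Finset.sum_fiberwise Finset.univ (fun x : F ↦ x ^ orderOf χ)]
        refine Finset.sum_congr rfl fun a _ ↦ ?_
        rw [Finset.sum_congr rfl fun x hx ↦ congrArg ψ (Finset.mem_filter.mp hx).2,
          Finset.sum_const, nsmul_eq_mul]
    _ = ∑ i ∈ Finset.range (orderOf χ), ∑ a : F, χ a ^ i * ψ a := by
        simp_rw [χ.card_pow_orderOf_eq, Finset.sum_mul]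
        exact Finset.sum_comm
    _ = _ := by
        rw [← Finset.add_sum_erase _ _ (Finset.mem_range.mpr hn)]
        simp only [pow_zero, one_mul, AddChar.sum_eq_zero_of_ne_one hψ, zero_add]
        refine Finset.sum_congr rfl fun i hi ↦ Finset.sum_congr rfl fun a _ ↦ ?_
        rw [pow_apply' χ (Finset.ne_of_mem_erase hi)]

end MulChar

/-- Translating the argument of the multiplicative character factors a Gauss sum out. -/
lemma sum_mulChar_add_mul_addChar {F R : Type*} [CommRing F] [Fintype F] [CommRing R]
    (χ : MulChar F R) (ψ : AddChar F R) (c : F) :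
    ∑ z : F, χ (c + z) * ψ z = gaussSum χ ψ * ψ (-c) := by
  rw [gaussSum, Finset.sum_mul, ← Equiv.sum_comp (Equiv.addLeft c) fun z ↦ χ z * ψ z * ψ (-c)]
  refine Finset.sum_congr rfl fun z _ ↦ ?_
  rw [Equiv.coe_addLeft, mul_assoc, ← AddChar.map_add_eq_mul, add_neg_cancel_comm]

lemma FiniteField.pow_bijective_of_coprime {F : Type*} [Field F] [Fintype F] {n : ℕ}
    (hn : n ≠ 0) (h : (Fintype.card F - 1).Coprime n) :
    Function.Bijective fun x : F ↦ x ^ n := by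
  refine Finite.injective_iff_bijective.mp fun x y hxy ↦ ?_
  change x ^ n = y ^ n at hxy
  rcases eq_or_ne x 0 with rfl | hx
  · exact (eq_zero_of_pow_eq_zero (by rw [← hxy, zero_pow hn])).symm
  have hy : y ≠ 0 := by
    rintro rfl
    exact hx (eq_zero_of_pow_eq_zero (by rw [hxy, zero_pow hn]))
  have hcard : (Nat.card Fˣ).Coprime n := by
    rwa [Nat.card_units, Nat.card_eq_fintype_card]
  have := (powCoprime hcard).injective (a₁ := Units.mk0 x hx) (a₂ := Units.mk0 y hy)
    (Units.ext (by simpa using hxy))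
  simpa using congrArg Units.val this


/-- Let `F` be a finite field of odd cardinality, `λ` its quadratic character
(the multiplicative character of order 2), `ψ` a nontrivial additive character, and
`S_F(λ, ψ) = Σ_{x,z ∈ F} λ(x³ + z)·ψ(z)`. Then `S_F(λ, ψ) = 0` if `|F| ≡ 2 (mod 3)`, and
`S_F(λ, ψ) = G_F(λ, ψ)·(G_F(χ, ψ) + G_F(χ², ψ))` if `|F| ≡ 1 (mod 3)`, where `χ` is either
of the two multiplicative characters of order exactly 3 and `G_F(·,·) = −gaussSum` is the
Gauss sum with the sign convention of the paper. -/
theorem statement3 (F : Type) [Field F] [Fintype F]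
    (hodd : Odd (Fintype.card F))
    (lam : MulChar F ℂ) (hlam : orderOf lam = 2)
    (ψ : AddChar F ℂ) (hψ : ψ ≠ 1) :
    (Fintype.card F % 3 = 2 → ∑ x : F, ∑ z : F, lam (x ^ 3 + z) * ψ z = 0) ∧
    (Fintype.card F % 3 = 1 → ∀ χ : MulChar F ℂ, orderOf χ = 3 →
      ∑ x : F, ∑ z : F, lam (x ^ 3 + z) * ψ z
        = (-gaussSum lam ψ) * ((-gaussSum χ ψ) + (-gaussSum (χ ^ 2) ψ))) := by
  have hS : ∑ x : F, ∑ z : F, lam (x ^ 3 + z) * ψ z =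
      gaussSum lam ψ * ∑ x : F, ψ (x ^ 3) := by
    simp only [sum_mulChar_add_mul_addChar]
    rw [← Finset.mul_sum, ← Equiv.sum_comp (Equiv.neg F) fun x ↦ ψ (x ^ 3)]
    simp [Odd.neg_pow (by decide : Odd 3)]
  rw [hS]
  refine ⟨fun h ↦ ?_, fun _ χ hχ ↦ ?_⟩
  · have hcop : (Fintype.card F - 1).Coprime 3 :=
      ((Nat.Prime.coprime_iff_not_dvd Nat.prime_three).mpr (by lia)).symm
    rw [(FiniteField.pow_bijective_of_coprime three_ne_zero hcop).sum_comp ψ,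
      AddChar.sum_eq_zero_of_ne_one hψ, mul_zero]
  · have hsum := χ.sum_addChar_pow_orderOf hψ
    rw [hχ, show (Finset.range 3).erase 0 = {1, 2} by decide,
      Finset.sum_pair (by decide), pow_one] at hsum
    rw [hsum]
    ring
end

section
/- Let F be a finite field of characteristic p > 3, let q = p^f be a power of p, let λ be the quadratic character of F (extended by λ(0) = 0), and let ψ_p be a fixed nontrivial additive character of F_p with values in ℂ. Then: (1) if |F| ≡ 2 (mod 3), Σ_{t ∈ F} Σ_{x ∈ F} λ(x³ + t^q − t) = 0; (2) if |F| ≡ 1 (mod 3), Σ_{t ∈ F} Σ_{x ∈ F} λ(x³ + t^q − t) = Σ_{α ∈ F^×, α^q = α} G_F(λ, ψ_α)·(G_F(χ, ψ_α) + G_F(χ², ψ_α)), where χ is either of the two multiplicative characters of F of order exactly 3 and the sum on the right runs over the nonzero elements of F fixed by the q-power Frobenius. -/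
/-- The additive character `ψ_α : x ↦ ψ_p(Tr_{F/F_p}(α·x))` of a finite field `F` of
characteristic `p`, built from a fixed additive character `ψ_p` of `F_p = ZMod p`. -/
noncomputable def psiAlpha {p : ℕ} [Fact p.Prime] {F : Type} [Field F] [Fintype F]
    [Algebra (ZMod p) F] (ψp : AddChar (ZMod p) ℂ) (α : F) : AddChar F ℂ :=
  ψp.compAddMonoidHom
    ((Algebra.trace (ZMod p) F).toAddMonoidHom.comp (AddMonoidHom.mulLeft α))

open Finset

section Helpers

variable {p : ℕ} [Fact p.Prime] {F : Type} [Field F] [Fintype F] [Algebra (ZMod p) F]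

theorem psiAlpha_apply (ψp : AddChar (ZMod p) ℂ) (α x : F) :
    psiAlpha ψp α x = ψp (Algebra.trace (ZMod p) F (α * x)) := rfl

theorem psiAlpha_eq_zero_iff {ψp : AddChar (ZMod p) ℂ} (hψ : ψp ≠ 1) (α : F) :
    psiAlpha ψp α = 0 ↔ α = 0 := by
  constructor
  · intro h
    by_contra hα
    apply hψ
    ext c
    obtain ⟨z, hz⟩ := Algebra.trace_surjective (ZMod p) F c
    have := DFunLike.congr_fun h (α⁻¹ * z)
    rw [psiAlpha_apply, mul_inv_cancel_left₀ hα, hz] at this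
    simpa using this
  · rintro rfl
    ext x
    simp [psiAlpha_apply]

theorem sum_psiAlpha [DecidableEq F] {ψp : AddChar (ZMod p) ℂ} (hψ : ψp ≠ 1) (α : F) :
    ∑ x, psiAlpha ψp α x = if α = 0 then (Fintype.card F : ℂ) else 0 := by
  classical
  rw [AddChar.sum_eq_ite]
  simp only [psiAlpha_eq_zero_iff hψ]

/-- Fourier inversion on a finite field. -/
theorem sum_sum_mul_psiAlpha {ψp : AddChar (ZMod p) ℂ} (hψ : ψp ≠ 1)
    (h : F → ℂ) (y : F) :
    ∑ α, (∑ x, h x * psiAlpha ψp α x) * psiAlpha ψp α (-y) = Fintype.card F * h y := by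
  classical
  simp only [sum_mul]
  rw [sum_comm]
  have key : ∀ x α : F, h x * psiAlpha ψp α x * psiAlpha ψp α (-y)
      = h x * psiAlpha ψp (x - y) α := by
    intro x α
    rw [mul_assoc, ← AddChar.map_add_eq_mul, psiAlpha_apply, psiAlpha_apply]
    ring_nf
  simp only [key, ← mul_sum, sum_psiAlpha hψ, sub_eq_zero]
  simp [mul_comm]

theorem trace_pow_prime_pow (f : ℕ) (z : F) :
    Algebra.trace (ZMod p) F (z ^ p ^ f) = Algebra.trace (ZMod p) F z := by
  induction f with
  | zero => simp
  | succ n ih =>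
    rw [pow_succ, pow_mul, ← ih]
    have := Algebra.trace_eq_of_algEquiv
      (FiniteField.frobeniusAlgEquivOfAlgebraic (ZMod p) F) (z ^ p ^ n)
    simpa [ZMod.card] using this

theorem sum_psiAlpha_pow_sub [DecidableEq F] {ψp : AddChar (ZMod p) ℂ} (hψ : ψp ≠ 1)
    (f : ℕ) (α : F) :
    ∑ t : F, psiAlpha ψp α (-(t ^ p ^ f - t))
      = if α ^ p ^ f = α then (Fintype.card F : ℂ) else 0 := by
  have : CharP F p := charP_of_injective_algebraMap (algebraMap (ZMod p) F).injective p
  have key : ∀ t : F, psiAlpha ψp α (-(t ^ p ^ f - t))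
      = psiAlpha ψp (α ^ p ^ f - α) (t ^ p ^ f) := by
    intro t
    rw [psiAlpha_apply, psiAlpha_apply]
    congr 1
    have h1 : α * -(t ^ p ^ f - t) = α * t - α * t ^ p ^ f := by ring
    rw [h1, sub_mul, map_sub, map_sub, ← mul_pow, trace_pow_prime_pow]
  have hbij : Function.Bijective (fun t : F => t ^ p ^ f) := by
    have := (iterateFrobenius F p f).injective
    rw [← Finite.injective_iff_bijective]
    intro a b hab
    exact this (by simpa [iterateFrobenius_def] using hab)
  simp only [key]
  rw [hbij.sum_comp (fun s => psiAlpha ψp (α ^ p ^ f - α) s), sum_psiAlpha hψ]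
  simp only [sub_eq_zero]

end Helpers

theorem cubic_character_values {F : Type} [Field F] {χ : MulChar F ℂ} (hχ : orderOf χ = 3) {y : F} (hy : y ≠ 0) :
    χ y = 1 ∨ 1 + χ y + (χ ^ 2) y = 0 := by
  have h3 : χ y ^ 3 = 1 := by
    rw [← MulChar.pow_apply' χ (by norm_num), ← hχ, pow_orderOf_eq_one,
      MulChar.one_apply hy.isUnit]
  rw [MulChar.pow_apply' χ (by norm_num)]
  have : (χ y - 1) * (1 + χ y + χ y ^ 2) = 0 := by linear_combination h3
  rcases mul_eq_zero.mp this with h | h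
  · exact Or.inl (sub_eq_zero.mp h)
  · exact Or.inr h

section Cubes

variable {F : Type} [Field F] [Fintype F] [DecidableEq F]

theorem card_filter_cube_eq_le (y : F) : #{x : F | x ^ 3 = y} ≤ 3 := by
  calc #{x : F | x ^ 3 = y} ≤ #(Polynomial.nthRoots 3 y).toFinset := by
        apply card_le_card
        intro x hx
        simpa [Polynomial.mem_nthRoots] using hx
    _ ≤ Multiset.card (Polynomial.nthRoots 3 y) := Multiset.toFinset_card_le _
    _ ≤ 3 := Polynomial.card_nthRoots 3 y

/-- A nonzero `y` has exactly `1 + χ(y) + χ²(y)` cube roots when `χ` is a cubic character. -/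
theorem card_filter_cube_eq {χ : MulChar F ℂ} (hχ : orderOf χ = 3) {y : F} (hy : y ≠ 0) :
    (#{x : F | x ^ 3 = y} : ℂ) = 1 + χ y + (χ ^ 2) y := by
  have hcube : ∀ x : F, x ≠ 0 → χ (x ^ 3) = 1 := by
    intro x hx
    rw [map_pow, ← MulChar.pow_apply' χ (by norm_num), ← hχ, pow_orderOf_eq_one,
      MulChar.one_apply hx.isUnit]
  have hempty : ∀ z : F, z ≠ 0 → χ z ≠ 1 → #{x : F | x ^ 3 = z} = 0 := by
    intro z hz hχz
    rw [card_eq_zero, filter_eq_empty_iff]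
    rintro x - rfl
    exact hχz (hcube x (by rintro rfl; simp at hz))
  set n : F → ℕ := fun z => if χ z = 1 then 3 else 0 with hn
  have hn_eq : ∀ z : F, z ≠ 0 → (n z : ℂ) = 1 + χ z + (χ ^ 2) z := by
    intro z hz
    by_cases h : χ z = 1
    · rw [MulChar.pow_apply' χ (by norm_num)]
      simp only [hn, h, if_true]
      norm_num
    · rw [(cubic_character_values hχ hz).resolve_left h]
      simp [hn, h]
  have hle : ∀ z ∈ univ.erase (0 : F), #{x : F | x ^ 3 = z} ≤ n z := by
    intro z hz
    by_cases h : χ z = 1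
    · simpa [hn, h] using card_filter_cube_eq_le z
    · simp [hempty z (ne_of_mem_erase hz) h]
  have hsum1 : ∑ z ∈ univ.erase (0 : F), #{x : F | x ^ 3 = z} = #(univ.erase (0 : F)) := by
    rw [card_eq_sum_card_fiberwise (f := fun x : F => x ^ 3) (t := univ.erase (0 : F))]
    · refine sum_congr rfl fun z hz => congrArg card ?_
      ext x
      have hz0 := ne_of_mem_erase hz
      simp only [mem_filter, mem_univ, true_and, mem_erase, and_true]
      refine ⟨fun h => ⟨?_, h⟩, fun h => h.2⟩
      rintro rfl
      exact hz0 (by simp [← h])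
    · intro x hx
      simpa using hx
  have hχ1 : χ ≠ 1 := by
    rintro rfl
    simp at hχ
  have hχ2 : χ ^ 2 ≠ 1 := fun h => by
    have := orderOf_dvd_of_pow_eq_one h
    rw [hχ] at this
    norm_num at this
  have hsum2 : ∑ z ∈ univ.erase (0 : F), n z = #(univ.erase (0 : F)) := by
    have h : ((∑ z ∈ univ.erase (0 : F), n z : ℕ) : ℂ) = (#(univ.erase (0 : F)) : ℕ) := by
      rw [Nat.cast_sum, sum_congr rfl fun z hz => hn_eq z (ne_of_mem_erase hz),
        sum_add_distrib, sum_add_distrib, sum_erase (f := fun z => χ z) _ (MulChar.map_zero χ),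
        sum_erase (f := fun z => (χ ^ 2) z) _ (MulChar.map_zero (χ ^ 2)), MulChar.sum_eq_zero_of_ne_one hχ1,
        MulChar.sum_eq_zero_of_ne_one hχ2]
      simp
    exact_mod_cast h
  have := (sum_eq_sum_iff_of_le hle).mp (hsum1.trans hsum2.symm) y (by simpa using hy)
  rw [this, hn_eq y hy]

/-- The sum of `ψ(x³)` over the field, for a nontrivial additive character `ψ`. -/
theorem sum_addChar_cube {χ : MulChar F ℂ} (hχ : orderOf χ = 3) {ψ : AddChar F ℂ} (hψ : ψ ≠ 0) :
    ∑ x : F, ψ (x ^ 3) = gaussSum χ ψ + gaussSum (χ ^ 2) ψ := by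
  have hcount : ∀ y : F, (#{x : F | x ^ 3 = y} : ℂ) = 1 + χ y + (χ ^ 2) y := by
    intro y
    by_cases hy : y = 0
    · subst hy
      have : ({x : F | x ^ 3 = 0} : Finset F) = {0} := by ext; simp
      rw [this, MulChar.map_zero, MulChar.map_zero]
      simp
    · exact card_filter_cube_eq hχ hy
  calc ∑ x : F, ψ (x ^ 3) = ∑ y : F, ∑ x : F with x ^ 3 = y, ψ (x ^ 3) :=
        (sum_fiberwise univ (fun x : F => x ^ 3) _).symm
    _ = ∑ y : F, (ψ y + χ y * ψ y + (χ ^ 2) y * ψ y) := by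
        refine sum_congr rfl fun y _ => ?_
        rw [sum_congr rfl fun x hx => by rw [(mem_filter.mp hx).2], sum_const, nsmul_eq_mul,
          hcount y]
        ring
    _ = gaussSum χ ψ + gaussSum (χ ^ 2) ψ := by
        rw [sum_add_distrib, sum_add_distrib, AddChar.sum_eq_zero_iff_ne_zero.mpr hψ, zero_add]
        rfl

theorem cube_bijective (h : Fintype.card F % 3 = 2) :
    Function.Bijective (fun x : F => x ^ 3) := by
  rw [← Finite.injective_iff_bijective]
  have hcop : (Nat.card Fˣ).Coprime 3 := by
    rw [Nat.card_units, Nat.card_eq_fintype_card, Nat.coprime_comm,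
      Nat.Prime.coprime_iff_not_dvd Nat.prime_three]
    omega
  intro a b hab
  simp only at hab
  by_cases ha : a = 0
  · subst ha
    exact (pow_eq_zero_iff three_ne_zero).mp (by simpa using hab.symm) |>.symm
  have hb : b ≠ 0 := by
    rintro rfl
    simp [ha] at hab
  have := (powCoprime hcop).injective (a₁ := Units.mk0 a ha) (a₂ := Units.mk0 b hb)
    (Units.ext (by simpa using hab))
  simpa using congrArg Units.val this

end Cubes

/-- For a finite field `F` of characteristic `p > 3`, a power `q = p^f`, the
quadratic character `λ` of `F`, and a fixed nontrivial additive character `ψ_p` of `F_p`: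
if `|F| ≡ 2 (mod 3)` then `Σ_{t,x ∈ F} λ(x³ + t^q − t) = 0`, and if `|F| ≡ 1 (mod 3)` then
`Σ_{t,x ∈ F} λ(x³ + t^q − t) = Σ_{α ∈ F^×, α^q = α} G_F(λ, ψ_α)·(G_F(χ, ψ_α) + G_F(χ², ψ_α))`
for either character `χ` of order exactly 3, with `G_F(·,·) = −gaussSum`. -/
theorem statement4 (p : ℕ) [Fact p.Prime] (hp : 3 < p)
    (F : Type) [Field F] [Fintype F] [DecidableEq F] [Algebra (ZMod p) F]
    (f : ℕ) (hf : 1 ≤ f) (q : ℕ) (hq : q = p ^ f)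
    (lam : MulChar F ℂ) (hlam : orderOf lam = 2)
    (ψp : AddChar (ZMod p) ℂ) (hψ : ψp ≠ 1) :
    (Fintype.card F % 3 = 2 → ∑ t : F, ∑ x : F, lam (x ^ 3 + (t ^ q - t)) = 0) ∧
    (Fintype.card F % 3 = 1 → ∀ χ : MulChar F ℂ, orderOf χ = 3 →
      ∑ t : F, ∑ x : F, lam (x ^ 3 + (t ^ q - t))
        = ∑ α ∈ Finset.univ.filter (fun α : F => α ≠ 0 ∧ α ^ q = α),
            (-gaussSum lam (psiAlpha ψp α)) *
              ((-gaussSum χ (psiAlpha ψp α)) + (-gaussSum (χ ^ 2) (psiAlpha ψp α)))) := by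
  refine ⟨fun hcard => ?_, fun _ χ hχ => ?_⟩
  · have hlam1 : lam ≠ 1 := by
      rintro rfl
      simp at hlam
    refine sum_eq_zero fun t _ => ?_
    rw [(cube_bijective hcard).sum_comp (fun y => lam (y + (t ^ q - t)))]
    exact (Equiv.sum_comp (Equiv.addRight (t ^ q - t)) (fun y => lam y)).trans
      (MulChar.sum_eq_zero_of_ne_one hlam1)
  · have hF : (Fintype.card F : ℂ) ≠ 0 := Nat.cast_ne_zero.mpr Fintype.card_ne_zero
    apply mul_left_cancel₀ hF
    subst hq
    have hsplit : ∀ t x α : F,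
        gaussSum lam (psiAlpha ψp α) * psiAlpha ψp α (-(x ^ 3 + (t ^ p ^ f - t)))
          = gaussSum lam (psiAlpha ψp α) *
            (psiAlpha ψp α (-(t ^ p ^ f - t)) * psiAlpha ψp α ((-x) ^ 3)) := by
      intro t x α
      rw [← AddChar.map_add_eq_mul]
      congr 2
      ring
    have hcube : ∀ α : F, ∑ x : F, psiAlpha ψp α ((-x) ^ 3) = ∑ x : F, psiAlpha ψp α (x ^ 3) :=
      fun α => Equiv.sum_comp (Equiv.neg F) (fun x => psiAlpha ψp α (x ^ 3))
    calc (Fintype.card F : ℂ) * ∑ t : F, ∑ x : F, lam (x ^ 3 + (t ^ p ^ f - t))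
        = ∑ t : F, ∑ x : F, ∑ α : F,
            gaussSum lam (psiAlpha ψp α) * psiAlpha ψp α (-(x ^ 3 + (t ^ p ^ f - t))) := by
          simp only [mul_sum]
          exact sum_congr rfl fun t _ => sum_congr rfl fun x _ =>
            (sum_sum_mul_psiAlpha hψ (fun y => lam y) _).symm
      _ = ∑ α : F, gaussSum lam (psiAlpha ψp α) *
            ((∑ t : F, psiAlpha ψp α (-(t ^ p ^ f - t))) * ∑ x : F, psiAlpha ψp α (x ^ 3)) := by
          simp only [hsplit]
          rw [sum_congr rfl fun t _ => sum_comm, sum_comm]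
          simp only [← mul_sum, hcube, ← sum_mul]
      _ = _ := by
          rw [sum_filter, mul_sum]
          refine sum_congr rfl fun α _ => ?_
          rw [sum_psiAlpha_pow_sub hψ]
          by_cases hα : α = 0
          · have hlam1 : lam ≠ 1 := by
              rintro rfl
              simp at hlam
            have h0 : gaussSum lam (psiAlpha ψp α) = 0 := by
              rw [(psiAlpha_eq_zero_iff hψ α).mpr hα]
              simpa [gaussSum] using MulChar.sum_eq_zero_of_ne_one hlam1
            simp only [h0, neg_zero, zero_mul, ite_self, mul_zero]
          · rw [sum_addChar_cube hχ (mt (psiAlpha_eq_zero_iff hψ α).mp hα)]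
            by_cases hfix : α ^ p ^ f = α
            · simp only [hfix, hα, ne_eq, not_false_eq_true, and_self, if_true]
              ring
            · simp [hfix]
end

section
/- Let k be a field, let V be a finite-dimensional k-vector space, let m ≥ 1 be an integer, and suppose V decomposes as an internal direct sum V = ⊕_{i ∈ ℤ/mℤ} W_i of subspaces indexed by ℤ/mℤ. Let φ : V → V be a k-linear map such that φ(W_i) ⊆ W_{i+1} for all i ∈ ℤ/mℤ. Then φ^m maps W₀ into itself, and in the polynomial ring k[T] one has det(1 − T·φ | V) = det(1 − T^m·ψ | W₀), where ψ : W₀ → W₀ is the restriction of φ^m to W₀. Here, for a k-linear endomorphism A of a finite-dimensional space U, det(1 − T·A | U) denotes the determinant of the k[T]-linear endomorphism id − T·(A ⊗ id) of U ⊗_k k[T]; equivalently it is the reverse of the characteristic polynomial of A. -/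
open Polynomial

namespace Matrix

variable {n o R : Type*} [Fintype n] [DecidableEq n] [Fintype o] [DecidableEq o]
  [CommRing R]

theorem charpolyRev_eq_one_of_isNilpotent [IsDomain R] {N : Matrix n n R} (hN : IsNilpotent N) :
    N.charpolyRev = 1 := by
  obtain ⟨r, -, hr⟩ := Polynomial.isUnit_iff.mp (isUnit_charpolyRev_of_isNilpotent hN)
  have h := eval_charpolyRev (M := N)
  rw [← hr, eval_C] at h
  rw [← hr, h, C_1]

theorem charpolyRev_comp_X_pow (M : Matrix n n R) (m : ℕ) :
    M.charpolyRev.comp (X ^ m) = det (1 - (X : R[X]) ^ m • M.map C) := by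
  rw [charpolyRev, ← coe_compRingHom_apply, RingHom.map_det]
  congr 1
  ext i j : 1
  by_cases h : i = j <;> simp [h]

/-- If `A - A * I * P` is nilpotent of order at most `m + 1` and only the last of the compressed
words `P * (A - A * I * P) ^ j * A * I` with `j ≤ m` is nonzero, then the reverse characteristic
polynomial of `A` is that of this last word, evaluated at `X ^ (m + 1)`. -/
theorem charpolyRev_eq_comp_of_compression [IsDomain R] (A N : Matrix n n R) (P : Matrix o n R)
    (I : Matrix n o R) (m : ℕ) (hA : A = N + A * I * P) (hN : N ^ (m + 1) = 0)
    (hP : ∀ j < m, P * N ^ j * A * I = 0) :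
    A.charpolyRev = (P * N ^ m * A * I).charpolyRev.comp (X ^ (m + 1)) := by
  set S : Matrix n n R[X] := ∑ j ∈ Finset.range (m + 1), ((X : R[X]) • N.map C) ^ j with hS
  have hpow (j : ℕ) : ((X : R[X]) • N.map C) ^ j = (X : R[X]) ^ j • (N ^ j).map C := by
    rw [_root_.smul_pow, Matrix.map_pow]
  have hinv : S * (1 - (X : R[X]) • N.map C) = 1 := by
    rw [hS, geom_sum_mul_neg, hpow, hN]
    simp
  have hdetN : det (1 - (X : R[X]) • N.map C) = 1 :=
    charpolyRev_eq_one_of_isNilpotent ⟨m + 1, hN⟩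
  have hdetS : det S = 1 := by
    have h := congrArg det hinv
    rwa [det_mul, hdetN, mul_one, det_one] at h
  have hfactor : S * (1 - (X : R[X]) • A.map C) =
      1 - ((X : R[X]) • (S * A.map C * I.map C)) * P.map C := by
    have hAC : A.map C = N.map C + A.map C * I.map C * P.map C := by
      conv_lhs => rw [hA]
      simp [Matrix.map_add, Matrix.map_mul]
    conv_lhs => rw [hAC]
    rw [smul_add, ← sub_sub, mul_sub, hinv]
    simp [Matrix.mul_assoc]
  have hword : P.map C * ((X : R[X]) • (S * A.map C * I.map C)) =
      (X : R[X]) ^ (m + 1) • (P * N ^ m * A * I).map C := by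
    have hterm (j : ℕ) : P.map C * ((X : R[X]) • (((X : R[X]) • N.map C) ^ j * A.map C * I.map C)) =
        (X : R[X]) ^ (j + 1) • (P * N ^ j * A * I).map C := by
      rw [hpow]
      simp only [Matrix.map_mul, Matrix.smul_mul, Matrix.mul_smul, smul_smul, pow_succ',
        Matrix.mul_assoc]
    rw [hS, Finset.sum_mul, Matrix.sum_mul, Finset.smul_sum, Matrix.mul_sum,
      Finset.sum_congr rfl fun j _ => hterm j, Finset.sum_range_succ, Finset.sum_eq_zero, zero_add]
    intro j hj
    rw [hP j (Finset.mem_range.mp hj)]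
    simp
  rw [charpolyRev_comp_X_pow, ← hword, ← det_one_sub_mul_comm, ← hfactor, det_mul, hdetS, one_mul,
    charpolyRev]

end Matrix

namespace LinearMap

variable {k V U : Type*} [Field k] [AddCommGroup V] [Module k V] [FiniteDimensional k V]
  [AddCommGroup U] [Module k U] [FiniteDimensional k U]

theorem reverse_charpoly_eq_comp_of_compression (φ N : Module.End k V) (p : V →ₗ[k] U)
    (i : U →ₗ[k] V) (ψ : Module.End k U) (m : ℕ) (hφ : φ = N + φ ∘ₗ i ∘ₗ p)
    (hN : N ^ (m + 1) = 0) (hp : ∀ j < m, p ∘ₗ (N ^ j) ∘ₗ φ ∘ₗ i = 0)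
    (hψ : p ∘ₗ (N ^ m) ∘ₗ φ ∘ₗ i = ψ) :
    φ.charpoly.reverse = ψ.charpoly.reverse.comp (X ^ (m + 1)) := by
  let b := Module.finBasis k V
  let c := Module.finBasis k U
  have hword (j : ℕ) : toMatrix c c (p ∘ₗ (N ^ j) ∘ₗ φ ∘ₗ i) =
      toMatrix b c p * toMatrix b b N ^ j * toMatrix b b φ * toMatrix c b i := by
    rw [toMatrix_comp c b c, toMatrix_comp c b b, toMatrix_comp c b b, toMatrix_pow]
    simp only [Matrix.mul_assoc]
  rw [← charpoly_toMatrix φ b, ← charpoly_toMatrix ψ c, Matrix.reverse_charpoly,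
    Matrix.reverse_charpoly, ← hψ, hword]
  apply Matrix.charpolyRev_eq_comp_of_compression
  · conv_lhs => rw [hφ]
    rw [map_add, toMatrix_comp b b b, toMatrix_comp b c b, Matrix.mul_assoc]
  · rw [toMatrix_pow, hN, map_zero]
  · intro j hj
    rw [← hword, hp j hj, map_zero]

end LinearMap

namespace DirectSum.IsInternal

variable {ι R M : Type*} [DecidableEq ι] [Semiring R] [AddCommMonoid M] [Module R M]
  {W : ι → Submodule R M}

theorem exists_projection (hW : DirectSum.IsInternal W) (i : ι) :
    ∃ p : M →ₗ[R] W i, (∀ x : W i, p x = x) ∧ ∀ j ≠ i, ∀ x ∈ W j, p x = 0 := by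
  let e := LinearEquiv.ofBijective (DirectSum.coeLinearMap W) hW
  have he (j : ι) (x : W j) : e.symm x = DirectSum.lof R ι (fun i => W i) j x := by
    rw [LinearEquiv.symm_apply_eq]
    exact (DirectSum.coeLinearMap_lof W j x).symm
  refine ⟨DirectSum.component R ι (fun i => W i) i ∘ₗ e.symm.toLinearMap, fun x => ?_,
    fun j hj x hx => ?_⟩
  · simp [he, DirectSum.component.lof_self]
  · have := he j ⟨x, hx⟩
    simp only at this
    simp [this, DirectSum.component.of, hj]

theorem linearMap_ext {N : Type*} [AddCommMonoid N] [Module R N] (hW : DirectSum.IsInternal W)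
    {f g : M →ₗ[R] N} (h : ∀ i, ∀ x ∈ W i, f x = g x) : f = g :=
  LinearMap.ext_on (s := ⋃ i, (W i : Set M))
    (by rw [← Submodule.iSup_eq_span, hW.submodule_iSup_eq_top]) fun x hx => by
      obtain ⟨i, hi⟩ := Set.mem_iUnion.mp hx
      exact h i x hi

end DirectSum.IsInternal

theorem pow_apply_mem_of_shift {k V : Type*} [Semiring k] [AddCommMonoid V] [Module k V] {m : ℕ}
    {W : ZMod m → Submodule k V} {f : Module.End k V} (hf : ∀ i, ∀ x ∈ W i, f x ∈ W (i + 1))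
    (j : ℕ) {i : ZMod m} {x : V} (hx : x ∈ W i) : (f ^ j) x ∈ W (i + j) := by
  induction j with
  | zero => simpa using hx
  | succ j ih =>
    rw [pow_succ', Module.End.mul_apply, Nat.cast_succ, ← add_assoc]
    exact hf _ _ ih


/-- If a finite-dimensional `k`-vector space `V` is the internal direct sum of
subspaces `W i` indexed by `ℤ/mℤ` and `φ : V → V` is linear with `φ(W i) ⊆ W (i+1)`, then
`φ^m` maps `W 0` into itself and `det(1 − T·φ | V) = det(1 − T^m·ψ | W 0)` where `ψ` is the
restriction of `φ^m` to `W 0`.  Here `det(1 − T·A | U)` is the reverse of the characteristic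
polynomial of `A`. -/
theorem statement5 (k : Type) [Field k] (V : Type) [AddCommGroup V] [Module k V]
    [FiniteDimensional k V]
    (m : ℕ) (hm : 0 < m) (W : ZMod m → Submodule k V)
    (hW : DirectSum.IsInternal W)
    (φ : V →ₗ[k] V) (hφ : ∀ i : ZMod m, ∀ x ∈ W i, φ x ∈ W (i + 1)) :
    ∃ h : ∀ x ∈ W 0, (φ ^ m) x ∈ W 0,
      (LinearMap.charpoly φ).reverse
        = ((LinearMap.charpoly ((φ ^ m).restrict h)).reverse).comp (X ^ m) := by
  obtain ⟨m, rfl⟩ := Nat.exists_eq_add_one.mpr hm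
  have h0 : ∀ x ∈ W 0, (φ ^ (m + 1)) x ∈ W 0 := fun x hx => by
    simpa only [ZMod.natCast_self, add_zero] using pow_apply_mem_of_shift hφ (m + 1) hx
  refine ⟨h0, ?_⟩
  obtain ⟨p, hp, hp'⟩ := hW.exists_projection 0
  let N : Module.End k V := φ - φ ∘ₗ (W 0).subtype ∘ₗ p
  have hN0 : ∀ x ∈ W 0, N x = 0 := fun x hx => by
    simp [N, hp ⟨x, hx⟩]
  have hN1 : ∀ i ≠ 0, ∀ x ∈ W i, N x = φ x := fun i hi x hx => by
    simp [N, hp' i hi x hx]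
  have hNW : ∀ i, ∀ x ∈ W i, N x ∈ W (i + 1) := fun i x hx => by
    by_cases hi : i = 0
    · subst hi
      rw [hN0 x hx]
      exact zero_mem _
    · rw [hN1 i hi x hx]
      exact hφ i x hx
  have hne (j : ℕ) (hj : j < m) : (0 + 1 + j : ZMod (m + 1)) ≠ 0 := by
    have : ((j + 1 : ℕ) : ZMod (m + 1)) ≠ 0 := by
      rw [Ne, ZMod.natCast_eq_zero_iff]
      exact Nat.not_dvd_of_pos_of_lt j.succ_pos (by lia)
    convert this using 1
    push_cast
    ring
  have hNφ (x : W 0) (j : ℕ) (hj : j ≤ m) : (N ^ j) (φ x) = (φ ^ (j + 1)) x := by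
    induction j with
    | zero => simp
    | succ j ih =>
      rw [pow_succ', Module.End.mul_apply,
        hN1 _ (hne j hj) _ (pow_apply_mem_of_shift hNW j (hφ 0 x x.2)), ih (by lia),
        pow_succ' φ (j + 1), Module.End.mul_apply]
  apply LinearMap.reverse_charpoly_eq_comp_of_compression φ N p (W 0).subtype
  · simp [N]
  · refine hW.linearMap_ext fun i x hx => ?_
    have hlt : (-i).val < m + 1 := ZMod.val_lt _
    have hmem := pow_apply_mem_of_shift hNW (-i).val hx
    rw [ZMod.natCast_zmod_val, add_neg_cancel] at hmem
    have hsplit : m + 1 = (m - (-i).val) + 1 + (-i).val := by lia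
    rw [hsplit, pow_add, pow_succ, Module.End.mul_apply, Module.End.mul_apply, hN0 _ hmem, map_zero,
      LinearMap.zero_apply]
  · intro j hj
    ext x : 1
    exact hp' _ (hne j hj) _ (pow_apply_mem_of_shift hNW j (hφ 0 x x.2))
  · ext x : 1
    have := hp ⟨_, h0 x x.2⟩
    simp only [LinearMap.comp_apply, Submodule.subtype_apply, hNφ x m le_rfl]
    exact this
end

section
/- Let p > 3 be a prime with p ≡ 5 (mod 6), and let F be a finite field with p^m elements where m is even. Let λ be the quadratic character of F, let χ be a multiplicative character of F of order exactly 3, and let α ∈ F^×. Then (G_F(λ, ψ_α) · G_F(χ, ψ_α))⁶ = p^{6m}. Equivalently, the product G_F(λ, ψ_α)·G_F(χ, ψ_α) equals ε·p^m for some sixth root of unity ε ∈ ℂ. -/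
theorem psiAlpha_eq_mulShift {p : ℕ} [Fact p.Prime] {F : Type} [Field F] [Fintype F]
    [Algebra (ZMod p) F] (ψp : AddChar (ZMod p) ℂ) (α : F) :
    psiAlpha ψp α = AddChar.mulShift (psiAlpha ψp 1) α := by
  ext x
  simp [psiAlpha, AddChar.mulShift_apply]

theorem psiAlpha_isPrimitive {p : ℕ} [Fact p.Prime] {F : Type} [Field F] [Fintype F]
    [Algebra (ZMod p) F] {ψp : AddChar (ZMod p) ℂ} (hψ : ψp ≠ 1) {α : F} (hα : α ≠ 0) :
    (psiAlpha ψp α).IsPrimitive := by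
  apply AddChar.IsPrimitive.of_ne_one
  rw [AddChar.ne_one_iff] at hψ ⊢
  obtain ⟨y, hy⟩ := hψ
  obtain ⟨x, hx⟩ := Algebra.trace_surjective (ZMod p) F y
  refine ⟨α⁻¹ * x, ?_⟩
  simpa [psiAlpha, hα, hx] using hy

theorem psiAlpha_one_pow {p : ℕ} [Fact p.Prime] {F : Type} [Field F] [Fintype F]
    [Algebra (ZMod p) F] (ψp : AddChar (ZMod p) ℂ) (x : F) :
    psiAlpha ψp 1 (x ^ p) = psiAlpha ψp 1 x := by
  have h := Algebra.trace_eq_of_algEquiv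
    (FiniteField.frobeniusAlgEquivOfAlgebraic (ZMod p) F) x
  rw [FiniteField.coe_frobeniusAlgEquivOfAlgebraic, ZMod.card] at h
  simp [psiAlpha, h]

/-- The Gauss sum at the trace character is invariant under the Frobenius action on the
multiplicative character. -/
theorem gaussSum_pow_psiAlpha_one {p : ℕ} [Fact p.Prime] {F : Type} [Field F] [Fintype F]
    [Algebra (ZMod p) F] (ψp : AddChar (ZMod p) ℂ) (χ : MulChar F ℂ) :
    gaussSum (χ ^ p) (psiAlpha ψp 1) = gaussSum χ (psiAlpha ψp 1) := by
  have hp : p ≠ 0 := (Fact.out : p.Prime).ne_zero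
  unfold gaussSum
  refine Fintype.sum_equiv (FiniteField.frobeniusAlgEquivOfAlgebraic (ZMod p) F).toEquiv _ _ ?_
  intro x
  have h : (FiniteField.frobeniusAlgEquivOfAlgebraic (ZMod p) F).toEquiv x = x ^ p := by
    have := congrFun (FiniteField.coe_frobeniusAlgEquivOfAlgebraic (ZMod p) F) x
    rwa [ZMod.card] at this
  rw [h, psiAlpha_one_pow, map_pow, MulChar.pow_apply' χ hp]

theorem MulChar.gaussSum_sq_of_inv_eq {F : Type} [Field F] [Fintype F] {χ : MulChar F ℂ}
    (hχ : χ ≠ 1) {ψ : AddChar F ℂ} (hψ : ψ.IsPrimitive)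
    (hinv : gaussSum χ⁻¹ ψ = gaussSum χ ψ) (hneg : χ (-1) = 1) :
    gaussSum χ ψ ^ 2 = Fintype.card F := by
  have h₁ := gaussSum_mul_gaussSum_eq_card hχ hψ
  have h₂ := mul_gaussSum_inv_eq_gaussSum χ⁻¹ ψ
  rw [MulChar.inv_apply', inv_neg_one, hneg, one_mul] at h₂
  rw [h₂, hinv] at h₁
  rw [sq, h₁]

theorem gaussSum_sq_of_orderOf_eq_two {F : Type} [Field F] [Fintype F]
    (hsq : IsSquare (-1 : F)) {χ : MulChar F ℂ} (hχ : orderOf χ = 2)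
    {ψ : AddChar F ℂ} (hψ : ψ.IsPrimitive) :
    gaussSum χ ψ ^ 2 = Fintype.card F := by
  have h2 : χ ^ 2 = 1 := hχ ▸ pow_orderOf_eq_one χ
  refine MulChar.gaussSum_sq_of_inv_eq ?_ hψ ?_ ?_
  · rintro rfl
    simp at hχ
  · rw [inv_eq_of_mul_eq_one_right (by rw [← sq, h2])]
  · obtain ⟨y, hy⟩ := hsq
    have hy0 : y ≠ 0 := by
      rintro rfl
      simp at hy
    rw [hy, map_mul, ← sq, ← MulChar.pow_apply' χ two_ne_zero, h2, MulChar.one_apply hy0.isUnit]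

theorem gaussSum_pow_six_of_orderOf_eq_three {p : ℕ} [Fact p.Prime] (hp3 : p % 3 = 2)
    {F : Type} [Field F] [Fintype F] [Algebra (ZMod p) F] {χ : MulChar F ℂ}
    (hχ : orderOf χ = 3) {α : F} (hα : α ≠ 0) {ψp : AddChar (ZMod p) ℂ} (hψ : ψp ≠ 1) :
    gaussSum χ (psiAlpha ψp α) ^ 6 = (Fintype.card F : ℂ) ^ 3 := by
  have h3 : χ ^ 3 = 1 := hχ ▸ pow_orderOf_eq_one χ
  have hval {x : F} (hx : x ≠ 0) : χ x ^ 3 = 1 := by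
    rw [← MulChar.pow_apply' χ three_ne_zero, h3, MulChar.one_apply hx.isUnit]
  have hsq : gaussSum χ (psiAlpha ψp 1) ^ 2 = Fintype.card F := by
    refine MulChar.gaussSum_sq_of_inv_eq ?_ (psiAlpha_isPrimitive hψ one_ne_zero) ?_ ?_
    · rintro rfl
      simp at hχ
    · have hinv : χ⁻¹ = χ ^ p := by
        rw [← pow_mod_orderOf χ p, hχ, hp3]
        exact inv_eq_of_mul_eq_one_right (by rw [← pow_succ', h3])
      rw [hinv, gaussSum_pow_psiAlpha_one]
    · have h := hval (neg_ne_zero.mpr (one_ne_zero (α := F)))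
      rwa [← map_pow, Odd.neg_one_pow (by decide)] at h
  have hshift := gaussSum_mulShift χ (psiAlpha ψp 1) (Units.mk0 α hα)
  rw [Units.val_mk0, ← psiAlpha_eq_mulShift] at hshift
  rw [← hsq, ← hshift]
  linear_combination (-(χ α ^ 3 + 1) * gaussSum χ (psiAlpha ψp α) ^ 6) * hval hα

/-- Let `p > 3` be a prime with `p ≡ 5 (mod 6)` and `F` a finite field with
`p^m` elements, `m` even.  For the quadratic character `λ` of `F`, any multiplicative
character `χ` of order exactly 3, and any `α ∈ F^×`:
`(G_F(λ, ψ_α)·G_F(χ, ψ_α))⁶ = p^{6m}`, i.e. the product `G_F(λ, ψ_α)·G_F(χ, ψ_α)` is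
`ε·p^m` for some sixth root of unity `ε`.  Here `G_F(·,·) = −gaussSum`. -/
theorem statement8 (p : ℕ) [Fact p.Prime] (hp : 3 < p) (hp6 : p % 6 = 5)
    (F : Type) [Field F] [Fintype F] [Algebra (ZMod p) F]
    (m : ℕ) (hm : Even m) (hF : Fintype.card F = p ^ m)
    (lam : MulChar F ℂ) (hlam : orderOf lam = 2)
    (χ : MulChar F ℂ) (hχ : orderOf χ = 3)
    (α : F) (hα : α ≠ 0)
    (ψp : AddChar (ZMod p) ℂ) (hψ : ψp ≠ 1) :
    ((-gaussSum lam (psiAlpha ψp α)) * (-gaussSum χ (psiAlpha ψp α))) ^ 6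
        = (p : ℂ) ^ (6 * m) ∧
    ∃ ε : ℂ, ε ^ 6 = 1 ∧
      (-gaussSum lam (psiAlpha ψp α)) * (-gaussSum χ (psiAlpha ψp α)) = ε * (p : ℂ) ^ m := by
  have hsq : IsSquare (-1 : F) := by
    rw [FiniteField.isSquare_neg_one_iff, hF]
    obtain ⟨k, rfl⟩ := hm
    rw [← two_mul, pow_mul, Nat.pow_mod, Nat.pow_mod p 2]
    have h : p % 4 = 1 ∨ p % 4 = 3 := by omega
    rcases h with h | h <;> simp [h]
  have hl := gaussSum_sq_of_orderOf_eq_two hsq hlam (psiAlpha_isPrimitive hψ hα)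
  have hc := gaussSum_pow_six_of_orderOf_eq_three (by omega) hχ hα hψ
  rw [hF, Nat.cast_pow] at hl hc
  have key : ((-gaussSum lam (psiAlpha ψp α)) * (-gaussSum χ (psiAlpha ψp α))) ^ 6
      = (p : ℂ) ^ (6 * m) := by
    calc _ = (gaussSum lam (psiAlpha ψp α) ^ 2) ^ 3 * gaussSum χ (psiAlpha ψp α) ^ 6 := by ring
      _ = _ := by rw [hl, hc]; ring
  have hp0 : (p : ℂ) ^ m ≠ 0 :=
    pow_ne_zero _ (Nat.cast_ne_zero.mpr (Fact.out : p.Prime).ne_zero)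
  refine ⟨key, _, ?_, (div_mul_cancel₀ _ hp0).symm⟩
  rw [div_pow, key, ← pow_mul, mul_comm m 6, div_self]
  rw [mul_comm, pow_mul]
  exact pow_ne_zero _ hp0
end

section
/- Let E be the elliptic curve over K = F_r(t) defined by y² = x³ + (t^q − t). If p ≡ 1 (mod 6), then E(K) = 0: the point at infinity O is the only K-rational point of E. -/
section Contract

open Polynomial

variable {k : Type*} [Field k] (p : ℕ) [Fact p.Prime]

theorem Polynomial.contract_C_mul (r : k) (g : k[X]) :
    contract p (C r * g) = C r * contract p g := by
  ext n
  simp [coeff_contract (NeZero.ne p)]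

theorem Polynomial.contract_sum {ι : Type*} (s : Finset ι) (g : ι → k[X]) :
    contract p (∑ i ∈ s, g i) = ∑ i ∈ s, contract p (g i) := by
  ext n
  simp [coeff_contract (NeZero.ne p)]

theorem Polynomial.contract_X_mul_X_sub_C_pow (r : k) :
    contract p (X * (X - C r) ^ (p - 1)) = X := by
  have hp : 1 < p := (Fact.out : p.Prime).one_lt
  have hd : ((X - C r) ^ (p - 1)).natDegree = p - 1 := by simp
  have hm : ((X - C r) ^ (p - 1)).Monic := (monic_X_sub_C r).pow _
  ext n
  rw [coeff_contract (NeZero.ne p), coeff_X]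
  rcases n with _ | _ | n
  · simp
  · rw [show (0 + 1) * p = (p - 1) + 1 by omega, coeff_X_mul]
    have := hm.coeff_natDegree
    rw [hd] at this
    simp [this]
  · rw [show (n + 1 + 1) * p = (n * p + p + (p - 1)) + 1 by
      have : (n + 1 + 1) * p = n * p + p + p := by ring
      omega, coeff_X_mul, coeff_eq_zero_of_natDegree_lt (by rw [hd]; omega)]
    simp

variable [CharP k p]

theorem Polynomial.pow_char_eq_expand_map_frobenius (a : k[X]) :
    a ^ p = expand k p (a.map (frobenius k p)) := by
  rw [← map_frobenius_expand, map_expand]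

theorem Polynomial.contract_mul_pow_char (g a : k[X]) :
    contract p (g * a ^ p) = contract p g * a.map (frobenius k p) := by
  rw [pow_char_eq_expand_map_frobenius, contract_mul_expand (NeZero.ne p)]

theorem Polynomial.contract_X_mul_derivative (a : k[X]) :
    contract p (X * derivative a) = 0 := by
  ext n
  rw [coeff_contract (NeZero.ne p), coeff_zero]
  rcases h : n * p with _ | j
  · simp
  · rw [coeff_X_mul, coeff_derivative]
    have : ((j : k) + 1) = 0 := by
      have : ((j + 1 : ℕ) : k) = 0 := by rw [← h]; simp
      exact_mod_cast this
    rw [this, mul_zero]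

theorem Polynomial.contract_map_frobenius (a : k[X]) :
    contract p (a.map (frobenius k p)) = (contract p a).map (frobenius k p) :=
  (map_contract (NeZero.ne p)).symm

/-- The Cartier operator sends `a ^ (p - 1) da` to `da`. -/
theorem Polynomial.contract_X_mul_pow_mul_derivative [IsAlgClosed k] (a : k[X]) :
    contract p (X * (a ^ (p - 1) * derivative a)) =
      X * (derivative a).map (frobenius k p) := by
  have hp : p - 1 + 1 = p := Nat.sub_add_cancel (Fact.out : p.Prime).one_le
  have key : ∀ a b : k[X],
      contract p (X * (a ^ (p - 1) * derivative a)) = X * (derivative a).map (frobenius k p) →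
      contract p (X * (b ^ (p - 1) * derivative b)) = X * (derivative b).map (frobenius k p) →
      contract p (X * ((a * b) ^ (p - 1) * derivative (a * b))) =
        X * (derivative (a * b)).map (frobenius k p) := by
    intro a b ha hb
    have h : X * ((a * b) ^ (p - 1) * derivative (a * b)) =
        (X * (a ^ (p - 1) * derivative a)) * b ^ p
          + (X * (b ^ (p - 1) * derivative b)) * a ^ p := by
      rw [derivative_mul, mul_pow]
      nth_rewrite 4 [← hp]
      nth_rewrite 6 [← hp]
      ring
    rw [h, contract_add (NeZero.ne p), contract_mul_pow_char, contract_mul_pow_char, ha, hb,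
      derivative_mul, Polynomial.map_add, Polynomial.map_mul, Polynomial.map_mul]
    ring
  rw [(IsAlgClosed.splits a).eq_prod_roots]
  apply key
  · simp [contract]
  · induction a.roots using Multiset.induction_on with
    | empty => simp [contract]
    | cons r s ih =>
      rw [Multiset.map_cons, Multiset.prod_cons]
      refine key _ _ ?_ ih
      simpa using contract_X_mul_X_sub_C_pow p r

end Contract

section Twist

open Polynomial

variable {k : Type*} [Field k] (p : ℕ) [Fact p.Prime] [CharP k p]

/-- The numerator of `3 f dx + x df / dt` for `x = a / b ^ 2`, where `df / dt = -1`. -/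
noncomputable def twistNumerator (f a b : k[X]) : k[X] :=
  3 * (f * (derivative a * b - 2 * a * derivative b)) + a * b

variable {p} {f a b c : k[X]}

/-- If `c ^ 2 = a ^ 3 + f * b ^ 6` with `a`, `b` coprime, then `c` divides the numerator of the
invariant differential. -/
theorem dvd_twistNumerator (hf : derivative f = -1) (hab : IsCoprime a b)
    (h : c ^ 2 = a ^ 3 + f * b ^ 6) : c ∣ twistNumerator f a b := by
  have hcop : IsCoprime c (a ^ 2) := by
    refine IsCoprime.pow_right (isCoprime_of_prime_dvd ?_ ?_)
    · rintro ⟨rfl, rfl⟩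
      have hb : IsUnit b := isCoprime_zero_left.1 hab
      have hz : f = 0 := by
        have : f * b ^ 6 = 0 := by linear_combination -h
        exact (mul_eq_zero.1 this).resolve_right (pow_ne_zero _ hb.ne_zero)
      simp [hz] at hf
    · intro π hπ hc ha
      have hb : ¬ π ∣ b := fun hb => hπ.not_isUnit (hab.isUnit_of_dvd' ha hb)
      have h2 : π ^ 2 ∣ f * b ^ 6 := by
        have h1 : π ^ 2 ∣ a ^ 3 :=
          (pow_dvd_pow_of_dvd ha 2).trans (pow_dvd_pow a (by norm_num))
        have := dvd_sub (pow_dvd_pow_of_dvd hc 2) h1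
        rwa [h, add_sub_cancel_left] at this
      have h3 : π ^ 2 ∣ f :=
        hπ.pow_dvd_of_dvd_mul_right 2 (fun hh => hb (hπ.dvd_of_dvd_pow hh)) h2
      obtain ⟨g, rfl⟩ := h3
      simp only [derivative_mul, derivative_pow, Nat.cast_ofNat, map_ofNat,
        Nat.add_one_sub_one, pow_one] at hf
      refine hπ.not_isUnit (isUnit_of_dvd_one ?_)
      refine ⟨-(2 * derivative π * g + π * derivative g), ?_⟩
      linear_combination hf
  refine hcop.dvd_of_dvd_mul_left ⟨2 * f * b * derivative c - 6 * f * derivative b * c + b * c, ?_⟩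
  have hd := congrArg derivative h
  simp only [derivative_add, derivative_mul, derivative_pow, hf] at hd
  simp only [Nat.cast_ofNat, map_ofNat] at hd
  norm_num at hd
  unfold twistNumerator
  linear_combination (-f * b) * hd + (6 * f * derivative b - b) * h

variable {m : ℕ}

/-- The numerator `g` of the invariant differential is an eigenvector of the Cartier operator
twisted by `f ^ (5 * m)`, with eigenvalue the Hasse invariant. -/
theorem contract_pow_mul [IsAlgClosed k] (hm : p = 6 * m + 1) (hf : derivative f = -1)
    (hS : f.map (frobenius k p) = f) (hc : c ≠ 0) (h : c ^ 2 = a ^ 3 + f * b ^ 6) {g : k[X]}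
    (hg : twistNumerator f a b = c * g) :
    contract p (f ^ (5 * m) * (X * g)) =
      C ((Nat.choose (3 * m) (2 * m) : ℕ) : k) * (X * g).map (frobenius k p) := by
  have hp0 : p ≠ 0 := NeZero.ne p
  have hpP : 6 * (m : k[X]) + 1 = 0 := by
    have : ((6 * m + 1 : ℕ) : k[X]) = 0 := by rw [← hm]; simp
    exact_mod_cast this
  have hcS : c.map (frobenius k p) ≠ 0 := by
    simpa using hc
  refine mul_right_cancel₀ hcS ?_
  rw [← contract_mul_pow_char]
  set N := twistNumerator f a b with hN
  have hexp : f ^ (5 * m) * (X * g) * c ^ p =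
      ∑ j ∈ Finset.range (3 * m + 1), C ((Nat.choose (3 * m) j : ℕ) : k) *
        (X * (a ^ (3 * j) * b ^ (6 * (3 * m - j)) * f ^ (8 * m - j) * N)) := by
    have : f ^ (5 * m) * (X * g) * c ^ p = f ^ (5 * m) * X * N * (a ^ 3 + f * b ^ 6) ^ (3 * m) := by
      rw [← h, hg, hm]; ring
    rw [this, add_pow, Finset.mul_sum]
    refine Finset.sum_congr rfl fun j hj => ?_
    have hj : j ≤ 3 * m := by simpa [Nat.lt_succ_iff] using hj
    rw [show 8 * m - j = 5 * m + (3 * m - j) by omega, mul_pow, pow_add, pow_mul, pow_mul,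
      C_eq_natCast]
    ring
  rw [hexp, contract_sum, Finset.sum_eq_single_of_mem (2 * m) (by simp; omega)]
  · rw [contract_C_mul, mul_assoc (C _)]
    congr 1
    have e1 : 3 * (2 * m) = p - 1 := by omega
    have e2 : 6 * (3 * m - 2 * m) = p - 1 := by omega
    have e3 : 8 * m - 2 * m = p - 1 := by omega
    have e4 : p - 1 + 1 = p := by omega
    rw [e1, e2, e3]
    have : X * (a ^ (p - 1) * b ^ (p - 1) * f ^ (p - 1) * N) =
        C 3 * (X * (a ^ (p - 1) * derivative a)) * (f * b) ^ p +
        C (-6) * (X * (b ^ (p - 1) * derivative b)) * (f * a) ^ p +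
        C (-1) * (X * (f ^ (p - 1) * derivative f)) * (a * b) ^ p := by
      have hpow : ∀ x : k[X], x ^ p = x ^ (p - 1) * x := fun x => by rw [← pow_succ, e4]
      rw [hf, hpow, hpow, hpow, hN, twistNumerator]
      simp only [C_neg, map_ofNat, C_1, mul_pow]
      ring
    rw [this, contract_add hp0, contract_add hp0, contract_mul_pow_char, contract_mul_pow_char,
      contract_mul_pow_char, contract_C_mul, contract_C_mul, contract_C_mul,
      contract_X_mul_pow_mul_derivative, contract_X_mul_pow_mul_derivative,
      contract_X_mul_pow_mul_derivative, hf, mul_assoc, ← Polynomial.map_mul,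
      show X * g * c = X * N by rw [hg]; ring, hN, twistNumerator]
    simp only [Polynomial.map_mul, Polynomial.map_add, Polynomial.map_sub, Polynomial.map_neg,
      Polynomial.map_one, hS, map_X, C_neg, map_ofNat, C_1, Polynomial.map_ofNat]
    ring
  · intro j hj hne
    have hj : j ≤ 3 * m := by simpa [Nat.lt_succ_iff] using hj
    have hj0 : ((3 * j + 1 : ℕ) : k) ≠ 0 := by
      rw [Ne, CharP.cast_eq_zero_iff k p]
      rintro ⟨d, hd⟩
      have : d < 2 := by
        by_contra! hd2
        have := Nat.mul_le_mul_left p hd2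
        omega
      interval_cases d <;> omega
    obtain ⟨u, hu⟩ : ∃ u, u = 3 * m - j := ⟨_, rfl⟩
    have hu' : (u : k[X]) + j = 3 * m := by
      have : ((u + j : ℕ) : k[X]) = ((3 * m : ℕ) : k[X]) := by congr 1; omega
      exact_mod_cast this
    have hv : 8 * m - j = 5 * m + u := by omega
    rw [← hu, hv]
    have hder : X * (a ^ (3 * j) * b ^ (6 * u) * f ^ (5 * m + u) * N) =
        C ((3 * j + 1 : ℕ) : k)⁻¹ * (X * derivative
          (3 * (a ^ (3 * j + 1) * b ^ (6 * u + 1) * f ^ (5 * m + u + 1)))) := by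
      have hC : C ((3 * j + 1 : ℕ) : k) ≠ 0 := C_ne_zero.2 hj0
      refine mul_left_cancel₀ hC ?_
      rw [← mul_assoc (C _) (C _), ← C_mul, mul_inv_cancel₀ hj0]
      simp only [derivative_mul, derivative_pow_succ, hf, hN, twistNumerator,
        derivative_ofNat, C_1, C_add, C_eq_natCast]
      push_cast
      have hu2 : (u : k[X]) = 3 * m - j := by linear_combination hu'
      rw [hu2]
      linear_combination (4 * X * a * b - 9 * X * f * a * derivative b) *
        (a ^ (3 * j) * b ^ (6 * u) * f ^ (5 * m + u)) * hpP
    rw [hder, contract_C_mul, contract_C_mul, contract_X_mul_derivative]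
    simp

end Twist

section Vanishing

open Polynomial

variable {k : Type*} [Field k] {p : ℕ} [Fact p.Prime]

theorem coeff_iterate_contract (n j : ℕ) (P : k[X]) :
    ((contract p)^[n] P).coeff j = P.coeff (j * p ^ n) := by
  induction n generalizing P with
  | zero => simp
  | succ n ih =>
    rw [Function.iterate_succ_apply, ih, coeff_contract (NeZero.ne p), pow_succ, mul_assoc]

theorem coeff_X_pow_sub_X_pow_mul {q E : ℕ} {H : k[X]} (hq : 1 < q) (hE : 6 * E + 5 = 5 * q)
    (hH : H.coeff 0 = 0) :
    ((X ^ q - X) ^ E * H).coeff (H.natDegree * q) = 0 := by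
  rw [sub_eq_add_neg, add_pow, Finset.sum_mul, finsetSum_coeff]
  refine Finset.sum_eq_zero fun j hj => ?_
  have hj : j ≤ E := by simpa [Nat.lt_succ_iff] using hj
  have : (X ^ q) ^ j * (-X) ^ (E - j) * (E.choose j : k[X]) * H =
      C ((-1) ^ (E - j) * (E.choose j : k)) * (X ^ (q * j + (E - j)) * H) := by
    rw [neg_pow, ← pow_mul, pow_add, C_mul, C_eq_natCast, C_pow, C_neg, C_1]
    ring
  rw [this, coeff_C_mul, coeff_X_pow_mul']
  refine mul_eq_zero_of_right _ ?_
  split_ifs with hle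
  · obtain ⟨i, hi⟩ := Nat.exists_eq_add_of_le hle
    rw [hi, Nat.add_sub_cancel_left]
    rcases Nat.eq_zero_or_pos i with rfl | hi0
    · exact hH
    refine coeff_eq_zero_of_natDegree_lt ?_
    by_contra! hD
    generalize H.natDegree = D at hi hD
    rcases lt_or_ge j D with hjD | hjD
    · obtain ⟨s, hs⟩ := Nat.exists_eq_add_of_lt hjD
      rw [hs] at hi hD
      have : (j + s + 1) * q = q * j + q + s * q := by ring
      have hsq : s ≤ s * q := Nat.le_mul_of_pos_right _ (by omega)
      omega
    · have : D * q ≤ q * j := by rw [mul_comm]; exact Nat.mul_le_mul_left _ hjD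
      omega
  · rfl

variable [CharP k p]

theorem iterate_contract_pow_mul {m : ℕ} {f H : k[X]} {B : ℕ} (hS : f.map (frobenius k p) = f)
    (h : contract p (f ^ (5 * m) * H) = C (B : k) * H.map (frobenius k p)) (hp : p = 6 * m + 1)
    (n E : ℕ) (hE : 6 * E + 5 = 5 * p ^ n) :
    (contract p)^[n] (f ^ E * H) = C ((B : k) ^ n) * H.map (iterateFrobenius k p n) := by
  induction n generalizing H E with
  | zero =>
    obtain rfl : E = 0 := by simpa using hE
    simp [iterateFrobenius_zero]
  | succ n ih =>
    obtain ⟨E', hE'⟩ : ∃ E', 6 * E' + 5 = 5 * p ^ n := by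
      have h6 : p ^ n % 6 = 1 := by
        rw [Nat.pow_mod, hp]; simp [Nat.add_mod]
      exact ⟨5 * (p ^ n / 6), by omega⟩
    have hEE : E = 5 * m + E' * p := by
      have h1 : 6 * E + 5 = p * (6 * E' + 5) := by rw [hE, hE']; ring
      have h2 : p * (6 * E' + 5) = 6 * (E' * p) + 5 * p := by ring
      omega
    rw [Function.iterate_succ_apply, hEE,
      show f ^ (5 * m + E' * p) * H = f ^ (5 * m) * H * (f ^ E') ^ p by ring,
      contract_mul_pow_char, h, Polynomial.map_pow, hS]
    have h' : contract p (f ^ (5 * m) * (C (B : k) * H.map (frobenius k p))) =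
        C (B : k) * (C (B : k) * H.map (frobenius k p)).map (frobenius k p) := by
      have := congrArg (Polynomial.map (frobenius k p)) h
      rw [← contract_map_frobenius, Polynomial.map_mul, Polynomial.map_pow, hS] at this
      rw [mul_left_comm, contract_C_mul, this]
    rw [mul_comm, ih h' E' hE', Polynomial.map_mul, Polynomial.map_map, ← mul_assoc]
    congr 1
    · simp [pow_succ]
    · congr 1
      ext x
      simp [iterateFrobenius_def, frobenius_def, pow_succ, pow_mul, pow_right_comm]

/-- The Cartier operator twisted by `f ^ (5 * m)`, where `f = X ^ q - X`, is nilpotent: it has no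
eigenvector with nonzero eigenvalue. -/
theorem eq_zero_of_contract_eq {m n q B : ℕ} {H : k[X]} (hp : p = 6 * m + 1) (hq : q = p ^ n)
    (hn : n ≠ 0) (hB : (B : k) ≠ 0) (hH : H.coeff 0 = 0)
    (hS : (X ^ q - X : k[X]).map (frobenius k p) = X ^ q - X)
    (h : contract p ((X ^ q - X) ^ (5 * m) * H) = C (B : k) * H.map (frobenius k p)) :
    H = 0 := by
  obtain ⟨E, hE⟩ : ∃ E, 6 * E + 5 = 5 * p ^ n := by
    have h6 : p ^ n % 6 = 1 := by
      rw [Nat.pow_mod, hp]; simp [Nat.add_mod]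
    exact ⟨5 * (p ^ n / 6), by omega⟩
  have h1 := congrArg (fun P : k[X] => P.coeff H.natDegree)
    (iterate_contract_pow_mul hS h hp n E hE)
  simp only [coeff_iterate_contract, coeff_C_mul, coeff_map] at h1
  rw [← hq, coeff_X_pow_sub_X_pow_mul (hq ▸ Nat.one_lt_pow hn (Fact.out : p.Prime).one_lt)
    (hq ▸ hE) hH] at h1
  simpa [hB, iterateFrobenius_def, NeZero.ne p] using h1.symm

end Vanishing

section Descent

open Polynomial

variable {k : Type*} [Field k] {q : ℕ} {a b c : k[X]}

theorem natDegree_X_pow_sub_X (hq : 1 < q) : (X ^ q - X : k[X]).natDegree = q := by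
  rw [natDegree_sub_eq_left_of_natDegree_lt (by simpa using hq), natDegree_X_pow]

theorem ne_zero_of_sq_eq (hq : 1 < q) (hq6 : q % 6 = 1) (hb : b ≠ 0)
    (h : c ^ 2 = a ^ 3 + (X ^ q - X) * b ^ 6) : a ≠ 0 ∧ c ≠ 0 := by
  have hdeg : ((X ^ q - X) * b ^ 6 : k[X]).natDegree = q + 6 * b.natDegree := by
    rw [natDegree_mul (ne_zero_of_natDegree_gt (n := 0)
      (by rw [natDegree_X_pow_sub_X hq]; omega)) (pow_ne_zero _ hb), natDegree_X_pow_sub_X hq,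
      natDegree_pow]
  constructor
  · rintro rfl
    have := congrArg natDegree h
    rw [natDegree_pow, zero_pow (by norm_num), zero_add, hdeg] at this
    omega
  · rintro rfl
    have h' : (-a) ^ 3 = (X ^ q - X) * b ^ 6 := by linear_combination h
    have := congrArg natDegree h'
    rw [natDegree_pow, natDegree_neg, hdeg] at this
    omega

/-- A solution can be normalized to one with `a`, `b` coprime. -/
theorem exists_isCoprime_of_sq_eq {f : k[X]} (ha : a ≠ 0) (hb : b ≠ 0)
    (h : c ^ 2 = a ^ 3 + f * b ^ 6) :
    ∃ a' b' c' : k[X], a' ≠ 0 ∧ b' ≠ 0 ∧ IsCoprime a' b' ∧ c' ^ 2 = a' ^ 3 + f * b' ^ 6 ∧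
      (a'.natDegree : ℤ) - 2 * b'.natDegree = a.natDegree - 2 * b.natDegree := by
  induction hd : b.natDegree using Nat.strong_induction_on generalizing a b c with
  | _ d ih =>
  by_cases hab : IsCoprime a b
  · exact ⟨a, b, c, ha, hb, hab, h, by rw [hd]⟩
  obtain ⟨π, hπ, ⟨a, rfl⟩, ⟨b, rfl⟩⟩ : ∃ π, Prime π ∧ π ∣ a ∧ π ∣ b := by
    by_contra! hno
    exact hab (isCoprime_of_prime_dvd (fun hh => ha hh.1) fun π hπ h1 h2 => hno π hπ h1 h2)
  have hπ0 := hπ.ne_zero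
  have dvd_of_sq : ∀ x y : k[X], x ^ 2 = π * y → ∃ z, x = π * z := fun x y hxy =>
    hπ.dvd_of_dvd_pow ⟨y, hxy⟩
  obtain ⟨c, rfl⟩ := dvd_of_sq c _ (h.trans
    (by ring : _ = π * (π ^ 2 * a ^ 3 + f * π ^ 5 * b ^ 6)))
  have h1 : c ^ 2 = π * (a ^ 3 + f * π ^ 3 * b ^ 6) :=
    mul_left_cancel₀ (pow_ne_zero 2 hπ0) (by linear_combination h)
  obtain ⟨c, rfl⟩ := dvd_of_sq c _ h1
  have h2 : π * c ^ 2 = a ^ 3 + f * π ^ 3 * b ^ 6 :=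
    mul_left_cancel₀ hπ0 (by linear_combination h1)
  obtain ⟨a, rfl⟩ : π ∣ a := hπ.dvd_of_dvd_pow (n := 3)
    ⟨c ^ 2 - f * π ^ 2 * b ^ 6, by linear_combination -h2⟩
  have h3 : c ^ 2 = π * (π * (a ^ 3 + f * b ^ 6)) :=
    mul_left_cancel₀ hπ0 (by linear_combination h2)
  obtain ⟨c, rfl⟩ := dvd_of_sq c _ h3
  have h4 : c ^ 2 = a ^ 3 + f * b ^ 6 :=
    mul_left_cancel₀ (pow_ne_zero 2 hπ0) (by linear_combination h3)
  have ha0 : a ≠ 0 := by rintro rfl; simp at ha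
  have hb0 : b ≠ 0 := by rintro rfl; simp at hb
  have hdπ : 0 < π.natDegree := hπ.irreducible.natDegree_pos
  rw [natDegree_mul hπ0 hb0] at hd
  obtain ⟨a', b', c', ha', hb', hab', h', hdeg⟩ := ih b.natDegree (by omega) ha0 hb0 h4 rfl
  refine ⟨a', b', c', ha', hb', hab', h', ?_⟩
  rw [hdeg, natDegree_mul hπ0 (mul_ne_zero hπ0 ha0), natDegree_mul hπ0 ha0, ← hd]
  push_cast
  ring

variable {p m n : ℕ} [CharP k p]

theorem derivative_X_pow_sub_X (hn : n ≠ 0) : derivative (X ^ p ^ n - X : k[X]) = -1 := by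
  simp [derivative_X_pow, hn]

variable [Fact p.Prime]

theorem exists_eq_pow_of_derivative_eq_zero [PerfectRing k p] {P : k[X]}
    (hP : derivative P = 0) : ∃ Q : k[X], P = Q ^ p := by
  refine ⟨(contract p P).map (frobeniusEquiv k p).symm, ?_⟩
  rw [pow_char_eq_expand_map_frobenius, Polynomial.map_map]
  conv_lhs => rw [← expand_contract p hP (NeZero.ne p)]
  congr 1
  ext n
  simp

theorem twistNumerator_eq_zero [IsAlgClosed k] (hp : p = 6 * m + 1) (hn : n ≠ 0) (hc : c ≠ 0)
    (hab : IsCoprime a b) (h : c ^ 2 = a ^ 3 + (X ^ p ^ n - X) * b ^ 6) :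
    twistNumerator (X ^ p ^ n - X) a b = 0 := by
  have hS : (X ^ p ^ n - X : k[X]).map (frobenius k p) = X ^ p ^ n - X := by simp
  have hd := derivative_X_pow_sub_X (k := k) (p := p) hn
  obtain ⟨g, hg⟩ := dvd_twistNumerator hd hab h
  have hB : ((Nat.choose (3 * m) (2 * m) : ℕ) : k) ≠ 0 := by
    rw [Ne, CharP.cast_eq_zero_iff k p]
    intro hdvd
    have h1 : p ∣ (3 * m).factorial :=
      hdvd.trans (by
        rw [← Nat.choose_mul_factorial_mul_factorial (show 2 * m ≤ 3 * m by omega), mul_assoc]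
        exact dvd_mul_right _ _)
    have := (Fact.out : p.Prime).dvd_factorial.1 h1
    omega
  have := eq_zero_of_contract_eq hp rfl hn hB (by simp) hS (contract_pow_mul hp hd hS hc h hg)
  rw [hg, (mul_eq_zero.1 this).resolve_left X_ne_zero, mul_zero]

/-- Every solution is, up to twist, the Frobenius image of another one. -/
theorem exists_descent [IsAlgClosed k] (hp : p = 6 * m + 1) (hm : m ≠ 0) (hn : n ≠ 0)
    (ha : a ≠ 0) (hb : b ≠ 0) (hc : c ≠ 0)
    (hab : IsCoprime a b) (h : c ^ 2 = a ^ 3 + (X ^ p ^ n - X) * b ^ 6) :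
    ∃ a' b' c' : k[X], b' ≠ 0 ∧ c' ^ 2 = a' ^ 3 + (X ^ p ^ n - X) * b' ^ 6 ∧
      (p : ℤ) * (a'.natDegree - 2 * b'.natDegree) =
        a.natDegree - 2 * b.natDegree + 2 * m * (p ^ n : ℕ) := by
  have hN := twistNumerator_eq_zero hp hn hc hab h
  have hd := derivative_X_pow_sub_X (k := k) (p := p) hn
  have hdeg := natDegree_X_pow_sub_X (k := k) (Nat.one_lt_pow hn (Fact.out : p.Prime).one_lt)
  have hf0 : (X ^ p ^ n - X : k[X]) ≠ 0 := by
    intro h0; rw [h0] at hd; simp at hd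
  set f : k[X] := X ^ p ^ n - X
  have hpP : 6 * (m : k[X]) + 1 = 0 := by
    have : ((6 * m + 1 : ℕ) : k[X]) = 0 := by rw [← hp]; simp
    exact_mod_cast this
  obtain ⟨m, rfl⟩ := Nat.exists_eq_succ_of_ne_zero hm
  obtain ⟨P, hP⟩ : ∃ P : k[X], a * b ^ (p - 2) * f ^ (2 * (m + 1)) = P ^ p := by
    refine exists_eq_pow_of_derivative_eq_zero ?_
    have h3 : (3 : k[X]) ≠ 0 := by
      intro h3
      have : (1 : k[X]) = 0 := by linear_combination hpP - 2 * (m + 1 : ℕ) * h3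
      exact one_ne_zero this
    refine mul_left_cancel₀ h3 ?_
    rw [mul_zero]
    rw [show p - 2 = 6 * m + 4 + 1 by omega, show 2 * (m + 1) = 2 * m + 1 + 1 by ring]
    simp only [derivative_mul, derivative_pow_succ, hd, C_add, C_1, C_eq_natCast]
    unfold twistNumerator at hN
    push_cast at hpP ⊢
    linear_combination b ^ (6 * m + 4) * f ^ (2 * m + 1) * hN +
      (3 * a * derivative b * f - a * b) * (b ^ (6 * m + 4) * f ^ (2 * m + 1)) * hpP
  have hQ2 : (c * b ^ (p - 3) * f ^ (3 * (m + 1)) * b ^ (2 * p)) ^ 2 =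
      ((P * b) ^ 3 + f * b ^ 6) ^ p := by
    have e3 : b ^ p = b ^ (p - 3) * b ^ 3 := by rw [← pow_add]; congr 1; omega
    have e2 : b ^ (p - 2) = b ^ (p - 3) * b := by rw [← pow_succ]; congr 1; omega
    have ef : f ^ p = f ^ (6 * (m + 1)) * f := by rw [← pow_succ]; congr 1
    have : ((P * b) ^ 3 + f * b ^ 6) ^ p = (P ^ p) ^ 3 * (b ^ p) ^ 3 + f ^ p * (b ^ p) ^ 6 := by
      rw [add_pow_char]; ring_nf
    rw [this, ← hP, ef, e2, show b ^ (2 * p) = (b ^ p) ^ 2 by ring, e3]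
    linear_combination (b ^ (p - 3) * f ^ (3 * (m + 1)) * (b ^ (p - 3) * b ^ 3) ^ 2) ^ 2 * h
  obtain ⟨Q, hQ⟩ : ∃ Q : k[X], c * b ^ (p - 3) * f ^ (3 * (m + 1)) * b ^ (2 * p) = Q ^ p := by
    refine exists_eq_pow_of_derivative_eq_zero ?_
    set R := c * b ^ (p - 3) * f ^ (3 * (m + 1)) * b ^ (2 * p)
    have hR0 : R ≠ 0 := by positivity
    have h2 : (2 : k) ≠ 0 := by
      intro h2
      have h2 : (2 : k[X]) = 0 := by
        have := congrArg (C : k →+* k[X]) h2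
        rwa [map_ofNat, map_zero] at this
      have : (1 : k[X]) = 0 := by linear_combination hpP - 3 * (m + 1 : ℕ) * h2
      exact one_ne_zero this
    have := congrArg derivative hQ2
    rw [derivative_pow, derivative_pow] at this
    simpa [hR0, h2] using this
  refine ⟨P * b, b, Q, hb, ?_, ?_⟩
  · rw [hQ, ← pow_mul, mul_comm p 2, pow_mul] at hQ2
    exact frobenius_inj k[X] p hQ2
  · have hP0 : P ≠ 0 := by
      rintro rfl
      rw [zero_pow (NeZero.ne p)] at hP
      simp [ha, hb, hf0] at hP
    have h1 := congrArg natDegree hP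
    rw [natDegree_mul (by simp [ha, hb]) (by simp [hf0]), natDegree_mul ha (by simp [hb]),
      natDegree_pow, natDegree_pow, natDegree_pow, hdeg] at h1
    rw [natDegree_mul hP0 hb]
    zify [show 2 ≤ p by omega] at h1
    push_cast
    linear_combination -h1

theorem pow_dvd_of_sq_eq [IsAlgClosed k] (hp : p = 6 * m + 1) (hm : m ≠ 0) (hn : n ≠ 0)
    (hb : b ≠ 0) (h : c ^ 2 = a ^ 3 + (X ^ p ^ n - X) * b ^ 6) (j : ℕ) :
    (p : ℤ) ^ j ∣ 3 * (a.natDegree - 2 * b.natDegree) - (p ^ n : ℕ) := by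
  have h1 : 1 < p ^ n := Nat.one_lt_pow hn (Fact.out : p.Prime).one_lt
  have h6 : p ^ n % 6 = 1 := by
    rw [Nat.pow_mod, hp]; simp [Nat.add_mod]
  induction j generalizing a b c with
  | zero => simp
  | succ j ih =>
    obtain ⟨a, b, c, ha', hb', hab, h', hdeg⟩ :=
      exists_isCoprime_of_sq_eq (ne_zero_of_sq_eq h1 h6 hb h).1 hb h
    rw [← hdeg]
    obtain ⟨a', b', c', hb'', h'', hdeg'⟩ := exists_descent hp hm hn ha' hb'
      (ne_zero_of_sq_eq h1 h6 hb' h').2 hab h'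
    obtain ⟨d, hd⟩ := ih hb'' h''
    refine ⟨d, ?_⟩
    have hpz : (p : ℤ) = 6 * m + 1 := by exact_mod_cast hp
    linear_combination (p : ℤ) * hd - 3 * hdeg' + ((p ^ n : ℕ) : ℤ) * hpz

theorem sq_ne_of_isAlgClosed [IsAlgClosed k] (hp : p = 6 * m + 1) (hm : m ≠ 0) (hn : n ≠ 0)
    (hb : b ≠ 0) : c ^ 2 ≠ a ^ 3 + (X ^ p ^ n - X) * b ^ 6 := by
  intro h
  have h6 : p ^ n % 6 = 1 := by
    rw [Nat.pow_mod, hp]; simp [Nat.add_mod]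
  set z : ℤ := 3 * (a.natDegree - 2 * b.natDegree) - (p ^ n : ℕ) with hz
  have hz0 : z ≠ 0 := by omega
  have h1 := pow_dvd_of_sq_eq hp hm hn hb h z.natAbs
  have h2 : p ^ z.natAbs ∣ z.natAbs := by
    have := Int.natAbs_dvd_natAbs.2 h1
    rwa [Int.natAbs_pow, Int.natAbs_natCast] at this
  have h3 := Nat.le_of_dvd (Int.natAbs_pos.2 hz0) h2
  exact absurd h3 (not_le.2 (Nat.lt_pow_self (Fact.out : p.Prime).one_lt))

end Descent

section RationalPoints

open Polynomial

variable {k : Type*} [Field k] {p m n : ℕ} [Fact p.Prime]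

theorem sq_ne_of_ringHom {a b c : k[X]} {L : Type*} [Field L] [IsAlgClosed L] [CharP L p]
    (φ : k →+* L) (hp : p = 6 * m + 1) (hm : m ≠ 0) (hn : n ≠ 0) (hb : b ≠ 0) :
    c ^ 2 ≠ a ^ 3 + (X ^ p ^ n - X) * b ^ 6 := by
  intro h
  have hmap := congrArg (Polynomial.map φ) h
  simp only [Polynomial.map_mul, Polynomial.map_pow, Polynomial.map_add, Polynomial.map_sub,
    Polynomial.map_X] at hmap
  exact sq_ne_of_isAlgClosed hp hm hn ((Polynomial.map_ne_zero_iff φ.injective).2 hb) hmap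

/-- The affine curve `y ^ 2 = x ^ 3 + (t ^ (p ^ n) - t)` has no points over `k(t)`. -/
theorem RatFunc.sq_ne [CharP k p] (hp : p = 6 * m + 1) (hm : m ≠ 0) (hn : n ≠ 0)
    (x y : RatFunc k) :
    y ^ 2 ≠ x ^ 3 + (RatFunc.X ^ p ^ n - RatFunc.X) := by
  intro h
  classical
  obtain ⟨⟨d, hdm⟩, hd⟩ :=
    IsLocalization.exist_integer_multiples_of_finset (nonZeroDivisors k[X]) ({x, y} : Finset _)
  obtain ⟨u, hu⟩ := hd x (by simp)
  obtain ⟨v, hv⟩ := hd y (by simp)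
  have hd0 : d ≠ 0 := nonZeroDivisors.ne_zero hdm
  have heq : (v * d ^ 2) ^ 2 = (u * d) ^ 3 + (Polynomial.X ^ p ^ n - Polynomial.X) * d ^ 6 := by
    apply IsFractionRing.injective k[X] (RatFunc k)
    simp only [map_mul, map_pow, map_add, map_sub, hu, hv, RatFunc.algebraMap_X,
      Algebra.smul_def]
    linear_combination (algebraMap k[X] (RatFunc k) d) ^ 6 * h
  have : CharP (AlgebraicClosure k) p := charP_of_injective_algebraMap
    (algebraMap k (AlgebraicClosure k)).injective p
  exact sq_ne_of_ringHom (algebraMap k (AlgebraicClosure k)) hp hm hn hd0 heq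

end RationalPoints

/-- For the elliptic curve `E : y² = x³ + (t^q − t)` over `K = F_r(t)`, if
`p ≡ 1 (mod 6)` then `E(K) = 0`: the point at infinity is the only `K`-rational point. -/
theorem statement10 (p : ℕ) [Fact p.Prime] (hp : 3 < p) (hp6 : p % 6 = 1)
    (ν f : ℕ) (hν : 1 ≤ ν) (hf : 1 ≤ f)
    (q : ℕ) (hq : q = p ^ f)
    (W : WeierstrassCurve.Affine (RatFunc (GaloisField p ν)))
    (hW : W = { a₁ := 0, a₂ := 0, a₃ := 0, a₄ := 0,
                a₆ := RatFunc.X ^ q - RatFunc.X }) :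
    ∀ P : W.Point, P = 0 := by
  subst hq
  intro P
  rcases P with _ | ⟨x, y, hxy⟩
  · rfl
  · exfalso
    have heq := (WeierstrassCurve.Affine.equation_iff ..).1 hxy.1
    subst hW
    refine RatFunc.sq_ne (m := p / 6) (n := f) (by omega) (by omega) (by omega) x y ?_
    simpa using heq
end

section
/- Let p be a prime with p ≡ 5 (mod 6) and let q = p^f be a power of p. Let S = {1, 5} × {1, …, q − 1} and let σ : S → S be the map sending (b, a) to (6 − b, a′), where a′ is the unique element of {1, …, q − 1} with a′ ≡ p·a − (p + 1)·b/6 + 1 (mod q − 1) (note 6 divides (p+1)·b for b ∈ {1,5} since p ≡ 5 (mod 6)). Let S₀ = {(1, a) ∈ S : a < q/6} and S₁ = {(5, a) ∈ S : a > 5q/6}. Then σ is a bijection of S, and for every orbit o of the cyclic group of permutations generated by σ one has |o ∩ S₀| = |o ∩ S₁|. -/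
namespace Statement14

/-- A self-bijection of a set that exchanges two conditions equates the numbers of points
satisfying them. -/
lemma ncard_inter_eq_of_bijOn {α : Type*} {o A B : Set α} {g : α → α} (hg : Set.BijOn g o o)
    (h : ∀ y ∈ o, (y ∈ A ↔ g y ∈ B)) : (o ∩ A).ncard = (o ∩ B).ncard := by
  have himage : g '' (o ∩ A) = o ∩ B := by
    ext z
    constructor
    · rintro ⟨y, ⟨hyo, hyA⟩, rfl⟩
      exact ⟨hg.mapsTo hyo, (h y hyo).1 hyA⟩
    · rintro ⟨hzo, hzB⟩
      obtain ⟨y, hyo, rfl⟩ := hg.surjOn hzo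
      exact ⟨y, ⟨hyo, (h y hyo).2 hzB⟩, rfl⟩
  rw [← himage, (hg.injOn.mono Set.inter_subset_left).ncard_image]

/-- If a self-bijection of a finite set raises a `ZMod n`-valued level by one, all levels are
equally populated. -/
lemma mul_ncard_level {α : Type*} {n : ℕ} [NeZero n] {o : Set α} (ho : o.Finite) {g : α → α}
    (hg : Set.BijOn g o o) (lv : α → ZMod n) (h : ∀ y ∈ o, lv (g y) = lv y + 1) (j : ZMod n) :
    n * (o ∩ {y | lv y = j}).ncard = o.ncard := by
  have hstep (i : ZMod n) :
      (o ∩ {y | lv y = i + 1}).ncard = (o ∩ {y | lv y = i}).ncard :=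
    (ncard_inter_eq_of_bijOn hg fun y hy => by simp [h y hy]).symm
  have hnat (m : ℕ) : (o ∩ {y | lv y = (m : ZMod n)}).ncard = (o ∩ {y | lv y = 0}).ncard := by
    induction m with
    | zero => simp
    | succ m ih => rw [Nat.cast_succ, hstep, ih]
  have hall (i : ZMod n) : (o ∩ {y | lv y = i}).ncard = (o ∩ {y | lv y = 0}).ncard := by
    rw [← hnat i.val, ZMod.natCast_zmod_val]
  classical
  have hcard := Finset.card_eq_sum_card_fiberwise (f := lv) (s := ho.toFinset)
    (t := Finset.univ) (fun _ _ => by simp)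
  have hfiber (i : ZMod n) :
      (ho.toFinset.filter (lv · = i)).card = (o ∩ {y | lv y = 0}).ncard := by
    rw [← hall i, ← Set.ncard_coe_finset]
    congr 1
    ext y
    simp
  simp only [hfiber, Finset.sum_const, Finset.card_univ, ZMod.card, smul_eq_mul] at hcard
  rw [hall j, Set.ncard_eq_toFinset_card o ho, hcard]

/-- In `{1, 5} × {1, …, M}` a point `(b, a)` is determined by `6a - b` modulo `6M`. -/
lemma eq_of_modEq {M : ℤ} {y z : ℤ × ℤ}
    (hy : (y.1 = 1 ∨ y.1 = 5) ∧ 1 ≤ y.2 ∧ y.2 ≤ M)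
    (hz : (z.1 = 1 ∨ z.1 = 5) ∧ 1 ≤ z.2 ∧ z.2 ≤ M)
    (h : 6 * y.2 - y.1 ≡ 6 * z.2 - z.1 [ZMOD 6 * M]) : y = z := by
  have h' := h.eq
  rw [Int.emod_eq_of_lt (by omega) (by omega), Int.emod_eq_of_lt (by omega) (by omega)] at h'
  ext <;> omega

/-- The map `σ` preserves `{1, 5} × {1, …, M}` and multiplies `6a - b` by `p` modulo `6M`. -/
lemma sigma_spec {p M b a : ℤ} (hp : p % 6 = 5) (hM : 0 < M) (hb : b = 1 ∨ b = 5) :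
    ((6 - b = 1 ∨ 6 - b = 5) ∧ 1 ≤ (p * a - (p + 1) * b / 6) % M + 1 ∧
      (p * a - (p + 1) * b / 6) % M + 1 ≤ M) ∧
    6 * ((p * a - (p + 1) * b / 6) % M + 1) - (6 - b) ≡ p * (6 * a - b) [ZMOD 6 * M] := by
  have h0 := Int.emod_nonneg (p * a - (p + 1) * b / 6) hM.ne'
  have h1 := Int.emod_lt_of_pos (p * a - (p + 1) * b / 6) hM
  refine ⟨⟨by omega, by omega, by omega⟩, ?_⟩
  have hd : 6 * ((p + 1) * b / 6) = (p + 1) * b := by rcases hb with rfl | rfl <;> omega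
  have hm : (p * a - (p + 1) * b / 6) % M ≡ p * a - (p + 1) * b / 6 [ZMOD M] := Int.mod_modEq _ _
  have h6 := (hm.mul_left' (c := 6)).add_right b
  have e1 : 6 * ((p * a - (p + 1) * b / 6) % M + 1) - (6 - b)
      = 6 * ((p * a - (p + 1) * b / 6) % M) + b := by ring
  have e2 : p * (6 * a - b) = 6 * (p * a - (p + 1) * b / 6) + b := by linear_combination hd
  rw [e1, e2]
  exact h6

/-- The effect of multiplication by `q` on `6a - b` modulo `6(q - 1)` when `q ≡ 1 (mod 6)`. -/
lemma modEq_mul_of_mod_one {q h : ℤ} (hq : q - 1 = 6 * h) (hh : 0 < h) {y z : ℤ × ℤ}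
    (hy : (y.1 = 1 ∨ y.1 = 5) ∧ 1 ≤ y.2 ∧ y.2 ≤ q - 1)
    (hz : (z.1 = 1 ∨ z.1 = 5) ∧ 1 ≤ z.2 ∧ z.2 ≤ q - 1)
    (hmod : 6 * z.2 - z.1 ≡ q * (6 * y.2 - y.1) [ZMOD 6 * (q - 1)]) :
    z.1 = y.1 ∧ ∃ s : ℤ, (s = 0 ∨ s = 1) ∧ z.2 = y.2 + h * (6 * s - y.1) := by
  obtain ⟨t, ht⟩ := hmod.symm.dvd
  obtain rfl : q = 6 * h + 1 := by omega
  have h1 : z.1 = y.1 := by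
    have : z.1 - y.1 = 6 * (z.2 - y.2 - h * (6 * y.2 - y.1) - 6 * h * t) := by
      linear_combination -ht
    omega
  have h2 : z.2 = y.2 + h * (6 * (y.2 + t) - y.1) := by
    rw [h1] at ht
    linarith
  refine ⟨h1, y.2 + t, ?_, h2⟩
  have hl : 6 * (y.2 + t) - y.1 < 6 := by
    refine lt_of_mul_lt_mul_left ?_ hh.le
    linarith
  have hr : -6 < 6 * (y.2 + t) - y.1 := by
    refine lt_of_mul_lt_mul_left ?_ hh.le
    linarith
  omega

/-- When `q ≡ 5 (mod 6)`, multiplication by `q` exchanges the two boundary sets. -/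
lemma boundary_iff_of_mod_five {q : ℤ} (hq : q % 6 = 5) (hq1 : 1 < q) {y z : ℤ × ℤ}
    (hy : (y.1 = 1 ∨ y.1 = 5) ∧ 1 ≤ y.2 ∧ y.2 ≤ q - 1)
    (hz : (z.1 = 1 ∨ z.1 = 5) ∧ 1 ≤ z.2 ∧ z.2 ≤ q - 1)
    (hmod : 6 * z.2 - z.1 ≡ q * (6 * y.2 - y.1) [ZMOD 6 * (q - 1)]) :
    (y.1 = 1 ∧ 1 ≤ y.2 ∧ 6 * y.2 < q) ↔ (z.1 = 5 ∧ z.2 ≤ q - 1 ∧ 5 * q < 6 * z.2) := by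
  obtain ⟨t, ht⟩ := hmod.symm.dvd
  have h1 : z.1 = 6 - y.1 := by
    obtain ⟨k, rfl⟩ : ∃ k, q = 6 * k + 5 := ⟨q / 6, by omega⟩
    have : z.1 - 5 * y.1 =
        6 * (z.2 - (6 * k + 5) * y.2 + k * y.1 - (6 * k + 4) * t) := by
      linear_combination -ht
    omega
  rcases hy.1 with hy1 | hy1
  · have hz1 : z.1 = 5 := by omega
    rw [hy1, hz1] at ht
    have h2 : 6 * z.2 = 6 * y.2 + 4 + (q - 1) * (6 * (y.2 + t) - 1) := by linarith
    have hl : 6 * (y.2 + t) - 1 < 6 := by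
      refine lt_of_mul_lt_mul_left (a := q - 1) ?_ (by omega)
      linarith
    have hr : -6 < 6 * (y.2 + t) - 1 := by
      refine lt_of_mul_lt_mul_left (a := q - 1) ?_ (by omega)
      linarith
    obtain hs | hs : y.2 + t = 0 ∨ y.2 + t = 1 := by omega
    all_goals
      rw [hs] at h2
      omega
  · omega

end Statement14

open Statement14 in

/-- Let `p ≡ 5 (mod 6)` be prime and `q = p^f`.  On
`S = {1, 5} × {1, …, q − 1}` consider the map `σ(b, a) = (6 − b, a′)` where `a′` is the
unique element of `{1, …, q − 1}` with `a′ ≡ p·a − (p + 1)·b/6 + 1 (mod q − 1)` (realised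
as `a′ = ((p·a − (p + 1)·b/6) mod (q − 1)) + 1`, the division `(p + 1)·b/6` being exact).
With `S₀ = {(1, a) : a < q/6}` and `S₁ = {(5, a) : a > 5q/6}`, the map `σ` is a bijection
of `S` and every orbit `o` of the cyclic group generated by `σ` (the classes of the
equivalence relation generated by `s ∼ σ(s)` for `s ∈ S`) satisfies
`|o ∩ S₀| = |o ∩ S₁|`. -/
theorem statement14 (p : ℕ) (hp : p.Prime) (hp6 : p % 6 = 5) (f : ℕ) (hf : 1 ≤ f)
    (q : ℕ) (hq : q = p ^ f)
    (σ : ℤ × ℤ → ℤ × ℤ)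
    (hσ : ∀ b a : ℤ, σ (b, a)
      = (6 - b, ((p : ℤ) * a - ((p : ℤ) + 1) * b / 6) % ((q : ℤ) - 1) + 1))
    (S S₀ S₁ : Set (ℤ × ℤ))
    (hS : S = {x | (x.1 = 1 ∨ x.1 = 5) ∧ 1 ≤ x.2 ∧ x.2 ≤ (q : ℤ) - 1})
    (hS₀ : S₀ = {x | x.1 = 1 ∧ 1 ≤ x.2 ∧ 6 * x.2 < (q : ℤ)})
    (hS₁ : S₁ = {x | x.1 = 5 ∧ x.2 ≤ (q : ℤ) - 1 ∧ 5 * (q : ℤ) < 6 * x.2}) :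
    Set.BijOn σ S S ∧
    ∀ x ∈ S,
      ({y | Relation.EqvGen (fun u v => u ∈ S ∧ σ u = v) x y} ∩ S₀).ncard
        = ({y | Relation.EqvGen (fun u v => u ∈ S ∧ σ u = v) x y} ∩ S₁).ncard := by
  have hp6' : (p : ℤ) % 6 = 5 := by omega
  have hqz : (q : ℤ) = (p : ℤ) ^ f := by rw [hq]; push_cast; rfl
  have hq5 : 5 ≤ q := by
    calc 5 ≤ p := by omega
      _ = p ^ 1 := (pow_one p).symm
      _ ≤ q := hq ▸ Nat.pow_le_pow_right hp.pos hf
  have hM : (0 : ℤ) < (q : ℤ) - 1 := by omega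
  have hmem (y : ℤ × ℤ) : y ∈ S ↔ (y.1 = 1 ∨ y.1 = 5) ∧ 1 ≤ y.2 ∧ y.2 ≤ (q : ℤ) - 1 := by
    rw [hS]; rfl
  have hmaps : Set.MapsTo σ S S := by
    rintro ⟨b, a⟩ hy
    rw [hmem, hσ]
    exact (sigma_spec hp6' hM ((hmem _).1 hy).1).1
  have hmul (y : ℤ × ℤ) (hy : y ∈ S) :
      6 * (σ y).2 - (σ y).1 ≡ p * (6 * y.2 - y.1) [ZMOD 6 * ((q : ℤ) - 1)] := by
    obtain ⟨b, a⟩ := y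
    rw [hσ]
    exact (sigma_spec hp6' hM ((hmem _).1 hy).1).2
  have hcop : IsCoprime (6 * ((q : ℤ) - 1)) (p : ℤ) := by
    refine IsCoprime.mul_left ?_ ?_
    · exact ⟨1 + (p / 6 : ℤ), -6 + 5, by omega⟩
    · refine ⟨-1, (p : ℤ) ^ (f - 1), ?_⟩
      rw [← pow_succ, Nat.sub_add_cancel hf, ← hqz]
      ring
  have hinj : Set.InjOn σ S := by
    intro y hy z hz hyz
    refine eq_of_modEq ((hmem _).1 hy) ((hmem _).1 hz) ?_
    have h := (hmul y hy).symm.trans (hyz ▸ hmul z hz)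
    rw [Int.modEq_iff_dvd, ← mul_sub] at h
    exact Int.modEq_iff_dvd.2 (hcop.dvd_of_dvd_mul_left h)
  have hfin : S.Finite := by
    refine ((Set.finite_Icc (1 : ℤ) 5).prod (Set.finite_Icc 1 ((q : ℤ) - 1))).subset ?_
    intro y hy
    have := (hmem y).1 hy
    simp only [Set.mem_prod, Set.mem_Icc]
    omega
  have hbij {o : Set (ℤ × ℤ)} (hoS : o ⊆ S) (ho : Set.MapsTo σ o o) : Set.BijOn σ o o :=
    ((hfin.subset hoS).injOn_iff_bijOn_of_mapsTo ho).1 (hinj.mono hoS)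
  refine ⟨hbij subset_rfl hmaps, fun x hx => ?_⟩
  set o := {y | Relation.EqvGen (fun u v => u ∈ S ∧ σ u = v) x y}
  have hoS : o ⊆ S := by
    intro y hy
    have hiff : ∀ u v, Relation.EqvGen (fun u v => u ∈ S ∧ σ u = v) u v → (u ∈ S ↔ v ∈ S) := by
      intro u v huv
      induction huv with
      | rel u v h => exact ⟨fun _ => h.2 ▸ hmaps h.1, fun _ => h.1⟩
      | refl u => rfl
      | symm u v _ ih => exact ih.symm
      | trans u v w _ _ ih₁ ih₂ => exact ih₁.trans ih₂
    exact (hiff x y hy).1 hx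
  have hobij : Set.BijOn σ o o := hbij hoS fun y hy =>
    Relation.EqvGen.trans _ _ _ hy (Relation.EqvGen.rel _ _ ⟨hoS hy, rfl⟩)
  have hofin : o.Finite := hfin.subset hoS
  have hiter := hobij.iterate f
  have hpow (y : ℤ × ℤ) (hy : y ∈ o) : 6 * (σ^[f] y).2 - (σ^[f] y).1
      ≡ q * (6 * y.2 - y.1) [ZMOD 6 * ((q : ℤ) - 1)] := by
    rw [hqz]
    rw [hqz] at hmul
    generalize (6 * ((p : ℤ) ^ f - 1)) = N at hmul ⊢
    clear hiter hqz hq hf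
    induction f with
    | zero => simp [Int.ModEq.refl]
    | succ m ih =>
      rw [Function.iterate_succ_apply', pow_succ', mul_assoc]
      exact (hmul _ (hoS ((hobij.iterate m).mapsTo hy))).trans (ih.mul_left _)
  have hq6 : (q : ℤ) % 6 = 1 ∨ (q : ℤ) % 6 = 5 := by
    rw [hqz]
    have hneg : (p : ℤ) ≡ -1 [ZMOD 6] := by
      change (p : ℤ) % 6 = -1 % 6
      omega
    have := (hneg.pow f).eq
    rcases neg_one_pow_eq_or ℤ f with h | h <;> rw [h] at this <;> omega
  rcases hq6 with hq6 | hq6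
  · obtain ⟨h, hh⟩ : ∃ h, (q : ℤ) - 1 = 6 * h := ⟨q / 6, by omega⟩
    have hh0 : 0 < h := by omega
    have key (y : ℤ × ℤ) (hy : y ∈ o) :=
      modEq_mul_of_mod_one hh hh0 ((hmem _).1 (hoS hy))
        ((hmem _).1 (hoS (hiter.mapsTo hy))) (hpow y hy)
    have hbb (b : ℤ) : Set.BijOn σ^[f] (o ∩ {y | y.1 = b}) (o ∩ {y | y.1 = b}) := by
      refine ⟨fun y hy => ⟨hiter.mapsTo hy.1, (key y hy.1).1.trans hy.2⟩,
        hiter.injOn.mono Set.inter_subset_left, fun z hz => ?_⟩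
      obtain ⟨y, hy, rfl⟩ := hiter.surjOn hz.1
      exact ⟨y, ⟨hy, (key y hy).1.symm.trans hz.2⟩, rfl⟩
    have hswap : (o ∩ {y | y.1 = 1}).ncard = (o ∩ {y | y.1 = 5}).ncard := by
      refine ncard_inter_eq_of_bijOn hobij fun y _ => ?_
      obtain ⟨b, a⟩ := y
      simp only [hσ, Set.mem_ofPred_eq]
      omega
    have hlv₁ := mul_ncard_level (n := 6) (hofin.inter_of_left {y | y.1 = 1}) (hbb 1)
      (fun y => -(((y.2 - 1) / h : ℤ) : ZMod 6)) (fun y hy => by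
        obtain ⟨-, s, -, hs⟩ := key y hy.1
        have hy1 : y.1 = 1 := hy.2
        have e : (σ^[f] y).2 - 1 = y.2 - 1 + h * (6 * s - 1) := by rw [hs, hy1]; ring
        rw [e, Int.add_mul_ediv_left _ _ hh0.ne']
        push_cast
        rw [show (6 : ZMod 6) = 0 from rfl]
        ring) 0
    have hlv₅ := mul_ncard_level (n := 6) (hofin.inter_of_left {y | y.1 = 5}) (hbb 5)
      (fun y => (((y.2 - 1) / h : ℤ) : ZMod 6)) (fun y hy => by
        obtain ⟨-, s, -, hs⟩ := key y hy.1
        have hy1 : y.1 = 5 := hy.2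
        have e : (σ^[f] y).2 - 1 = y.2 - 1 + h * (6 * (s - 1) + 1) := by rw [hs, hy1]; ring
        rw [e, Int.add_mul_ediv_left _ _ hh0.ne']
        push_cast
        rw [show (6 : ZMod 6) = 0 from rfl]
        ring) ((5 : ℤ) : ZMod 6)
    have hdiv (y : ℤ × ℤ) (hy : y ∈ o) : 0 ≤ (y.2 - 1) / h ∧ (y.2 - 1) / h < 6 := by
      have := (hmem y).1 (hoS hy)
      exact ⟨Int.ediv_nonneg (by omega) hh0.le, Int.ediv_lt_of_lt_mul hh0 (by omega)⟩
    have e₀ : o ∩ S₀ = o ∩ {y | y.1 = 1} ∩ {y | -(((y.2 - 1) / h : ℤ) : ZMod 6) = 0} := by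
      ext y
      rw [hS₀, Set.inter_assoc]
      refine and_congr_right fun hy => ?_
      have hd := hdiv y hy
      have hyS := (hmem y).1 (hoS hy)
      have hlt := Int.ediv_lt_iff_lt_mul (a := y.2 - 1) (b := 1) hh0
      simp only [Set.mem_inter_iff, Set.mem_ofPred_eq, neg_eq_zero,
        ZMod.intCast_zmod_eq_zero_iff_dvd]
      omega
    have e₁ : o ∩ S₁ = o ∩ {y | y.1 = 5} ∩
        {y | (((y.2 - 1) / h : ℤ) : ZMod 6) = ((5 : ℤ) : ZMod 6)} := by
      ext y
      rw [hS₁, Set.inter_assoc]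
      refine and_congr_right fun hy => ?_
      have hd := hdiv y hy
      have hyS := (hmem y).1 (hoS hy)
      have hle := Int.le_ediv_iff_mul_le (a := 5) (b := y.2 - 1) hh0
      simp only [Set.mem_inter_iff, Set.mem_ofPred_eq, ZMod.intCast_eq_intCast_iff_dvd_sub]
      omega
    rw [e₀, e₁]
    omega
  · refine ncard_inter_eq_of_bijOn hiter fun y hy => ?_
    rw [hS₀, hS₁]
    exact boundary_iff_of_mod_five hq6 (by omega) ((hmem _).1 (hoS hy))
      ((hmem _).1 (hoS (hiter.mapsTo hy))) (hpow y hy)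
end

section
/- Let p be a prime, r = p^ν a power of p, and n ≥ 1 an integer coprime to p. There exists a constant C > 0, depending only on r and n, such that for every power q = p^f of p, the number of orbits of the permutation σ on S^×_{n,q} = (ℤ/nℤ)^× × F_q^× is at most C·q/log q. -/
/-- If every point outside `B` has period at least `f / ν` under `σ`, then the number of orbits
of `σ`, multiplied by `f`, is at most `ν * |X| + f * |B|`. -/
theorem card_quot_perm_mul_le {X : Type*} [Fintype X] (σ : Equiv.Perm X) (f ν : ℕ)
    (B : Finset X) (hB : ∀ x ∉ B, f ≤ ν * Function.minimalPeriod σ x) :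
    Nat.card (Quot (fun a b => σ a = b)) * f ≤ ν * Fintype.card X + f * B.card := by
  classical
  have hfin : Finite (Quot (fun a b => σ a = b)) := Quot.finite _
  have := Fintype.ofFinite (Quot (fun a b => σ a = b))
  let π : X → Quot (fun a b => σ a = b) := Quot.mk _
  have hiter : ∀ (x : X) (k : ℕ), π (σ^[k] x) = π x := by
    intro x k
    induction k with
    | zero => rfl
    | succ k ih =>
      rw [Function.iterate_succ_apply', ← ih]
      exact (Quot.sound (r := fun a b => σ a = b) rfl).symm
  have hfiber : ∀ c : Quot (fun a b => σ a = b),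
      f ≤ ∑ x with π x = c, (ν + if x ∈ B then f else 0) := by
    intro c
    obtain ⟨x, rfl⟩ := Quot.exists_rep c
    by_cases hx : x ∈ B
    · calc f ≤ ν + if x ∈ B then f else 0 := by simp [hx]
        _ ≤ _ := Finset.single_le_sum (f := fun x => ν + if x ∈ B then f else 0)
            (fun _ _ => Nat.zero_le _) (by simp [π])
    · have hcard : Function.minimalPeriod σ x ≤
          (Finset.univ.filter fun y => π y = Quot.mk _ x).card := by
        calc Function.minimalPeriod σ x
            = (Finset.range (Function.minimalPeriod σ x)).card := by simp
          _ ≤ _ := Finset.card_le_card_of_injOn (fun k => σ^[k] x)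
            (fun k _ => by simpa using hiter x k)
            (fun a ha b hb hab => Function.iterate_injOn_Iio_minimalPeriod
              (by simpa using ha) (by simpa using hb) hab)
      calc f ≤ ν * Function.minimalPeriod σ x := hB x hx
        _ ≤ ν * _ := Nat.mul_le_mul_left ν hcard
        _ ≤ _ := by
          rw [Finset.sum_add_distrib, Finset.sum_const, smul_eq_mul, mul_comm]
          exact Nat.le_add_right _ _
  calc Nat.card (Quot (fun a b => σ a = b)) * f
      = ∑ _c : Quot (fun a b => σ a = b), f := by simp [Nat.card_eq_fintype_card]
    _ ≤ ∑ c : Quot (fun a b => σ a = b), ∑ x with π x = c, (ν + if x ∈ B then f else 0) :=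
      Finset.sum_le_sum fun c _ => hfiber c
    _ = ∑ x, (ν + if x ∈ B then f else 0) := Finset.sum_fiberwise _ _ _
    _ = ν * Fintype.card X + f * B.card := by
      simp [Finset.sum_add_distrib, mul_comm]

/-- The exponents `a` for which `x` is fixed by the `p ^ a`-th power map are closed under gcd. -/
theorem pow_prime_pow_gcd_eq_self {M : Type*} [Monoid M] {p a b : ℕ} {x : M}
    (ha : x ^ p ^ a = x) (hb : x ^ p ^ b = x) : x ^ p ^ Nat.gcd a b = x := by
  have h : ∀ k, Function.IsPeriodicPt (fun y : M => y ^ p) k x ↔ x ^ p ^ k = x := fun k => by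
    rw [Function.IsPeriodicPt, Function.IsFixedPt, pow_iterate]
  exact (h _).1 (((h a).2 ha).gcd ((h b).2 hb))

theorem sum_Icc_pow_mul_le {p : ℕ} (hp : 2 ≤ p) (f : ℕ) :
    f * ∑ d ∈ Finset.Icc 1 (f / 2), p ^ d ≤ 4 * p ^ f := by
  have hsum : ∀ m, ∑ d ∈ Finset.Icc 1 m, p ^ d ≤ 2 * p ^ m := by
    intro m
    induction m with
    | zero => simp
    | succ m ih =>
      rw [Finset.sum_Icc_succ_top (by omega), pow_succ]
      nlinarith [Nat.mul_le_mul_left (p ^ m) hp]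
  have hlin : f ≤ 2 * p ^ (f - f / 2) := by
    have := (Nat.lt_pow_self (n := f - f / 2) (show 1 < p by omega)).le
    omega
  calc _ ≤ (2 * p ^ (f - f / 2)) * (2 * p ^ (f / 2)) := Nat.mul_le_mul hlin (hsum _)
    _ = 4 * (p ^ (f - f / 2) * p ^ (f / 2)) := by ring
    _ = 4 * p ^ f := by rw [← pow_add, Nat.sub_add_cancel (Nat.div_le_self f 2)]

/-- The units of a finite field lying in a subfield of degree at most `m` number at most
`∑ d ≤ m, p ^ d`. -/
theorem card_units_pow_prime_pow_le {F : Type*} [Field F] [Fintype Fˣ] [DecidableEq Fˣ]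
    {p : ℕ} (hp : 2 ≤ p) (m : ℕ) :
    ((Finset.Icc 1 m).biUnion fun d =>
      Finset.univ.filter fun α : Fˣ => α ^ p ^ d = α).card ≤ ∑ d ∈ Finset.Icc 1 m, p ^ d := by
  refine Finset.card_biUnion_le.trans (Finset.sum_le_sum fun d hd => ?_)
  have h1 : 1 < p ^ d := Nat.one_lt_pow (by have := Finset.mem_Icc.1 hd; omega) (by omega)
  refine le_trans (Finset.card_le_card fun α hα => ?_)
    ((IsCyclic.card_pow_eq_one_le (α := Fˣ) (n := p ^ d - 1) (by omega)).trans (Nat.sub_le _ _))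
  simp only [Finset.mem_filter, Finset.mem_univ, true_and] at hα ⊢
  refine mul_right_cancel (b := α) ?_
  rw [← pow_succ, Nat.sub_add_cancel h1.le, hα, one_mul]

/-- Let `p` be prime, `r = p^ν`, and `n ≥ 1` coprime to `p`.  There is a
constant `C > 0` depending only on `r` and `n` such that for every power `q = p^f`, the
number of orbits on `S^×_{n,q} = (ℤ/nℤ)^× × F_q^×` of the permutation
`σ(i, α) = (r·i, α^{1/r})` (where `α^{1/r}` is the unique `r`-th root, i.e. the inverse of
the `r`-power Frobenius) is at most `C·q/log q`.  Orbits are counted as the classes of the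
quotient by the equivalence relation generated by `x ∼ σ(x)`. -/
theorem statement17 (p ν n : ℕ) [Fact p.Prime] (hν : 1 ≤ ν) (hn : 1 ≤ n)
    (hpn : Nat.Coprime p n) :
    ∃ C : ℝ, 0 < C ∧
      ∀ f : ℕ, 1 ≤ f →
        ∀ σ : Equiv.Perm ((ZMod n)ˣ × (GaloisField p f)ˣ),
          (∀ x : (ZMod n)ˣ × (GaloisField p f)ˣ,
            ((σ x).1 : ZMod n) = (p : ZMod n) ^ ν * (x.1 : ZMod n) ∧
            ((σ x).2 : GaloisField p f) ^ (p ^ ν) = (x.2 : GaloisField p f)) →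
          (Nat.card (Quot (fun a b => σ a = b)) : ℝ)
            ≤ C * ((p : ℝ) ^ f) / Real.log ((p : ℝ) ^ f) := by
  classical
  have hp : 2 ≤ p := (Fact.out : p.Prime).two_le
  have hlog : 0 < Real.log p := Real.log_pos (by exact_mod_cast hp)
  have : NeZero n := ⟨by omega⟩
  set N := Fintype.card (ZMod n)ˣ with hN
  have hNpos : 0 < N := Fintype.card_pos
  refine ⟨N * (ν + 4) * Real.log p, by positivity, fun f hf σ hσ => ?_⟩
  have := Fintype.ofFinite (GaloisField p f)
  have hq : Fintype.card (GaloisField p f) = p ^ f := by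
    rw [← Nat.card_eq_fintype_card, GaloisField.card p f (by omega)]
  set A : Finset (GaloisField p f)ˣ := (Finset.Icc 1 (f / 2)).biUnion fun d =>
    Finset.univ.filter fun α => α ^ p ^ d = α with hA
  have hσ2 : ∀ (k : ℕ) x, (σ^[k] x).2 ^ p ^ (ν * k) = x.2 := by
    intro k
    induction k with
    | zero => simp
    | succ k ih =>
      intro x
      rw [Function.iterate_succ_apply, Nat.mul_succ, pow_add, pow_mul, ih]
      exact Units.ext (by simpa using (hσ x).2)
  have hcount := card_quot_perm_mul_le σ f ν (Finset.univ ×ˢ A) (fun x hx => by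
    have hpos : 0 < Function.minimalPeriod σ x :=
      Function.minimalPeriod_pos_of_mem_periodicPts (σ.injective.mem_periodicPts x)
    set k := Function.minimalPeriod σ x with hk
    have h1 : x.2 ^ p ^ (ν * k) = x.2 := by
      have := hσ2 k x
      rwa [hk, Function.iterate_minimalPeriod, ← hk] at this
    have h2 : x.2 ^ p ^ f = x.2 := Units.ext (by
      rw [Units.val_pow_eq_pow_val, ← hq, FiniteField.pow_card])
    have hg := pow_prime_pow_gcd_eq_self h1 h2
    have hgpos : 0 < Nat.gcd (ν * k) f := Nat.gcd_pos_of_pos_right _ (by omega)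
    obtain ⟨c, hc⟩ := Nat.gcd_dvd_right (ν * k) f
    have hlt : f / 2 < Nat.gcd (ν * k) f := by
      by_contra! hle
      exact hx (by simpa [hA] using ⟨_, ⟨hgpos, hle⟩, hg⟩)
    have hc2 : c < 2 := by
      by_contra! h
      have := Nat.mul_le_mul_left (Nat.gcd (ν * k) f) h
      omega
    have hgf : Nat.gcd (ν * k) f = f := by
      interval_cases c <;> omega
    exact Nat.le_of_dvd (by positivity) (Nat.gcd_eq_right_iff_dvd.1 hgf))
  have hU : Fintype.card (GaloisField p f)ˣ ≤ p ^ f := by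
    rw [← hq]
    exact Fintype.card_le_of_injective _ Units.val_injective
  have hAcard : f * A.card ≤ 4 * p ^ f :=
    (Nat.mul_le_mul_left f (card_units_pow_prime_pow_le hp (f / 2))).trans
      (sum_Icc_pow_mul_le hp f)
  have hmain : Nat.card (Quot (fun a b => σ a = b)) * f ≤ N * (ν + 4) * p ^ f := by
    rw [Fintype.card_prod, Finset.card_product, Finset.card_univ, ← hN] at hcount
    calc _ ≤ ν * (N * Fintype.card (GaloisField p f)ˣ) + f * (N * A.card) := hcount
      _ = N * (ν * Fintype.card (GaloisField p f)ˣ + f * A.card) := by ring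
      _ ≤ N * (ν * p ^ f + 4 * p ^ f) := by gcongr
      _ = _ := by ring
  have hmain' : (Nat.card (Quot (fun a b => σ a = b)) : ℝ) * f ≤ N * (ν + 4) * (p : ℝ) ^ f := by
    exact_mod_cast hmain
  have hf0 : (0 : ℝ) < f := by exact_mod_cast hf
  rw [Real.log_pow, le_div_iff₀ (by positivity)]
  calc _ = (Nat.card (Quot (fun a b => σ a = b)) : ℝ) * f * Real.log p := by ring
    _ ≤ N * (ν + 4) * (p : ℝ) ^ f * Real.log p := by gcongr
    _ = _ := by ring
end

section
/- Let p be a prime, r = p^ν a power of p, and n ≥ 1 an integer coprime to p. There exists a constant C > 0, depending only on r and n, such that for every power q = p^f of p with q ≥ 16, the sum over all orbits o of the permutation σ on S^×_{n,q} = (ℤ/nℤ)^× × F_q^× of log |o| (where |o| is the cardinality of the orbit o) is at most C·q·(log log q)/(log q). -/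
theorem quot_mk_eq_iff_sameCycle {S : Type*} (σ : Equiv.Perm S) (x y : S) :
    Quot.mk (fun a b => σ a = b) y = Quot.mk (fun a b => σ a = b) x ↔ σ.SameCycle x y := by
  constructor
  · intro h
    refine Equiv.Perm.SameCycle.symm ?_
    have h' := Quot.eqvGen_exact h
    induction h' with
    | rel a b hab => exact ⟨1, by simpa using hab⟩
    | refl a => exact Equiv.Perm.SameCycle.refl _ _
    | symm a b _ ih => exact (ih (Quot.eqvGen_sound ‹_›)).symm
    | trans a b c hab hbc ih1 ih2 =>
      exact (ih1 (Quot.eqvGen_sound hab)).trans (ih2 (Quot.eqvGen_sound hbc))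
  · rintro ⟨k, rfl⟩
    have step (z : S) : Quot.mk (fun a b => σ a = b) (σ z) = Quot.mk (fun a b => σ a = b) z :=
      (Quot.sound (r := fun a b => σ a = b) rfl).symm
    induction k using Int.induction_on with
    | zero => rfl
    | succ i ih => rw [add_comm, zpow_add, zpow_one, Equiv.Perm.mul_apply, step, ih]
    | pred i ih =>
      rw [← ih, ← step, ← Equiv.Perm.mul_apply, ← zpow_one_add]
      congr 3
      ring

theorem card_quot_class_eq_minimalPeriod {S : Type*} [Finite S] (σ : Equiv.Perm S) (x : S) :
    Nat.card {y | Quot.mk (fun a b => σ a = b) y = Quot.mk (fun a b => σ a = b) x}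
      = Function.minimalPeriod σ x := by
  have := Fintype.ofFinite (MulAction.orbit (Subgroup.zpowers σ) x)
  have h := MulAction.minimalPeriod_eq_card (a := σ) (b := x)
  rw [← Nat.card_eq_fintype_card] at h
  refine Eq.trans ?_ h.symm
  congr 2
  ext y
  rw [Set.mem_ofPred_eq, quot_mk_eq_iff_sameCycle, MulAction.mem_orbit_iff]
  constructor
  · rintro ⟨k, hk⟩
    exact ⟨⟨σ ^ k, k, rfl⟩, hk⟩
  · rintro ⟨⟨_, k, rfl⟩, hk⟩
    exact ⟨k, hk⟩

theorem finsum_log_card_quot_eq_sum {S : Type*} [Fintype S] (σ : Equiv.Perm S) :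
    (∑ᶠ o : Quot (fun a b => σ a = b),
      Real.log (Nat.card {x | Quot.mk (fun a b => σ a = b) x = o}))
      = ∑ x : S, Real.log (Function.minimalPeriod σ x) / (Function.minimalPeriod σ x : ℝ) := by
  classical
  have := Fintype.ofFinite (Quot (fun a b => σ a = b))
  rw [finsum_eq_sum_of_fintype,
    ← Finset.sum_fiberwise Finset.univ (fun x => Quot.mk (fun a b => σ a = b) x)]
  refine Finset.sum_congr rfl fun o _ => ?_
  induction o using Quot.ind with
  | mk x =>
  rw [Finset.sum_congr rfl (g := fun _ =>
    Real.log (Function.minimalPeriod σ x) / (Function.minimalPeriod σ x : ℝ))]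
  · have hc : (Finset.univ.filter fun y => Quot.mk (fun a b => σ a = b) y
        = Quot.mk (fun a b => σ a = b) x).card = Function.minimalPeriod σ x := by
      rw [← card_quot_class_eq_minimalPeriod σ x, Nat.card_eq_fintype_card,
        ← Set.toFinset_card]
      congr 1
      ext; simp
    have hpos : 0 < Function.minimalPeriod σ x :=
      Function.minimalPeriod_pos_of_mem_periodicPts
        (Function.Injective.mem_periodicPts σ.injective x)
    rw [Finset.sum_const, hc, card_quot_class_eq_minimalPeriod, nsmul_eq_mul]
    field_simp
  · intro y hy
    rw [Finset.mem_filter] at hy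
    rw [← card_quot_class_eq_minimalPeriod σ x, ← card_quot_class_eq_minimalPeriod σ y, hy.2]

theorem finsum_log_card_quot_le {S : Type*} [Finite S] (σ : Equiv.Perm S) (N : ℕ) (hN : 1 ≤ N)
    (hσ : ∀ x, (σ^[N]) x = x) (t : ℝ) (ht : 0 < t) :
    (∑ᶠ o : Quot (fun a b => σ a = b),
      Real.log (Nat.card {x | Quot.mk (fun a b => σ a = b) x = o}))
      ≤ Real.log N * (Nat.card S / t + Nat.card {x | (Function.minimalPeriod σ x : ℝ) < t}) := by
  classical
  have := Fintype.ofFinite S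
  rw [finsum_log_card_quot_eq_sum]
  have key (x : S) : Real.log (Function.minimalPeriod σ x) / (Function.minimalPeriod σ x : ℝ)
      ≤ Real.log N * (1 / t + if (Function.minimalPeriod σ x : ℝ) < t then 1 else 0) := by
    have hpos : 0 < Function.minimalPeriod σ x :=
      Function.minimalPeriod_pos_of_mem_periodicPts
        (Function.Injective.mem_periodicPts σ.injective x)
    have hle : Function.minimalPeriod σ x ≤ N :=
      Function.IsPeriodicPt.minimalPeriod_le hN (hσ x)
    set m := Function.minimalPeriod σ x
    have hm : (1 : ℝ) ≤ m := by exact_mod_cast hpos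
    have hlog : Real.log m ≤ Real.log N := Real.log_le_log (by positivity) (by exact_mod_cast hle)
    rw [div_eq_mul_inv]
    refine mul_le_mul hlog ?_ (by positivity) (Real.log_natCast_nonneg N)
    split_ifs with h
    · have : (m : ℝ)⁻¹ ≤ 1 := inv_le_one_of_one_le₀ hm
      have : 0 < 1 / t := by positivity
      linarith
    · rw [add_zero, ← one_div]
      exact one_div_le_one_div_of_le ht (not_lt.mp h)
  refine (Finset.sum_le_sum fun x _ => key x).trans (le_of_eq ?_)
  rw [← Finset.mul_sum, Finset.sum_add_distrib, Finset.sum_const, Finset.card_univ,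
    Finset.sum_boole, Nat.card_eq_fintype_card (α := S), Nat.card_eq_fintype_card,
    ← Set.toFinset_card, nsmul_eq_mul, mul_one_div]
  congr 4
  ext; simp

theorem card_units_exists_pow_pow_eq_self_le {K : Type*} [Field K] [Finite K] (p m : ℕ)
    (hp : 2 ≤ p) :
    Nat.card {a : Kˣ | ∃ j, 1 ≤ j ∧ j ≤ m ∧ a ^ p ^ j = a} ≤ p ^ (m + 1) := by
  classical
  have := Fintype.ofFinite Kˣ
  set T : Finset Kˣ :=
    (Finset.Icc 1 m).biUnion fun j => Finset.univ.filter fun a : Kˣ => a ^ (p ^ j - 1) = 1 with hT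
  have hsub : {a : Kˣ | ∃ j, 1 ≤ j ∧ j ≤ m ∧ a ^ p ^ j = a} ⊆ (T : Set Kˣ) := by
    rintro a ⟨j, h1, h2, h⟩
    simp only [hT, Finset.coe_biUnion, Set.mem_iUnion, Finset.mem_coe, Finset.mem_filter,
      Finset.mem_univ, true_and, Finset.mem_Icc]
    refine ⟨j, ⟨h1, h2⟩, ?_⟩
    have hpj : 1 ≤ p ^ j := Nat.one_le_pow _ _ (by omega)
    rw [← Nat.sub_add_cancel hpj, pow_succ] at h
    simpa using h
  calc Nat.card {a : Kˣ | ∃ j, 1 ≤ j ∧ j ≤ m ∧ a ^ p ^ j = a}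
      ≤ Nat.card (T : Set Kˣ) := Nat.card_mono T.finite_toSet hsub
    _ = T.card := by rw [Nat.card_coe_set_eq, Set.ncard_coe_finset]
    _ ≤ ∑ j ∈ Finset.Icc 1 m, (Finset.univ.filter fun a : Kˣ => a ^ (p ^ j - 1) = 1).card :=
      Finset.card_biUnion_le
    _ ≤ ∑ j ∈ Finset.Icc 1 m, p ^ j := by
      refine Finset.sum_le_sum fun j hj => ?_
      have hj1 := (Finset.mem_Icc.mp hj).1
      have : 2 ^ 1 ≤ p ^ j := (Nat.pow_le_pow_left hp 1).trans
        (Nat.pow_le_pow_right (by omega) hj1)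
      exact (IsCyclic.card_pow_eq_one_le (by omega)).trans (Nat.sub_le _ _)
    _ ≤ p ^ (m + 1) := (Nat.geomSum_lt hp fun k hk => by
        have := (Finset.mem_Icc.mp hk).2; omega).le

theorem frobenius_twist_iterate_spec {p ν n : ℕ} {K : Type*} [Field K]
    (σ : Equiv.Perm ((ZMod n)ˣ × Kˣ))
    (hσ : ∀ x : (ZMod n)ˣ × Kˣ,
      ((σ x).1 : ZMod n) = (p : ZMod n) ^ ν * (x.1 : ZMod n) ∧
        ((σ x).2 : K) ^ (p ^ ν) = (x.2 : K)) (k : ℕ) (x : (ZMod n)ˣ × Kˣ) :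
    (((σ^[k]) x).1 : ZMod n) = (p : ZMod n) ^ (ν * k) * (x.1 : ZMod n) ∧
      ((σ^[k]) x).2 ^ (p ^ (ν * k)) = x.2 := by
  induction k with
  | zero => simp
  | succ k ih =>
    rw [Function.iterate_succ_apply']
    obtain ⟨h1, h2⟩ := hσ ((σ^[k]) x)
    refine ⟨by rw [h1, ih.1]; ring, ?_⟩
    have h2' : (σ ((σ^[k]) x)).2 ^ (p ^ ν) = ((σ^[k]) x).2 := Units.ext (by simpa using h2)
    rw [Nat.mul_succ, add_comm, pow_add, pow_mul, h2', ih.2]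

theorem frobenius_twist_iterate_eq_self {p ν n f : ℕ} (hpn : Nat.Coprime p n)
    {K : Type*} [Field K] [Finite K] (hK : Nat.card K = p ^ f)
    (σ : Equiv.Perm ((ZMod n)ˣ × Kˣ))
    (hσ : ∀ x : (ZMod n)ˣ × Kˣ,
      ((σ x).1 : ZMod n) = (p : ZMod n) ^ ν * (x.1 : ZMod n) ∧
        ((σ x).2 : K) ^ (p ^ ν) = (x.2 : K)) (x : (ZMod n)ˣ × Kˣ) :
    (σ^[n.totient * f]) x = x := by
  have := Fintype.ofFinite K
  obtain ⟨h1, h2⟩ := frobenius_twist_iterate_spec σ hσ (n.totient * f) x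
  refine Prod.ext (Units.ext ?_) ?_
  · have hu : (p : ZMod n) ^ n.totient = 1 := by
      have := congrArg Units.val (ZMod.pow_totient (ZMod.unitOfCoprime p hpn))
      rwa [Units.val_pow_eq_pow_val, ZMod.coe_unitOfCoprime, Units.val_one] at this
    rw [h1, mul_left_comm, pow_mul, hu, one_pow, one_mul]
  · rw [← h2]
    refine Units.ext ?_
    rw [show p ^ (ν * (n.totient * f)) = Fintype.card K ^ (ν * n.totient) by
      rw [← Nat.card_eq_fintype_card, hK, ← pow_mul]; ring]
    rw [Units.val_pow_eq_pow_val, FiniteField.pow_card_pow]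

theorem card_frobenius_twist_minimalPeriod_lt_le {p ν n f : ℕ} (hp : 2 ≤ p) (hν : 1 ≤ ν)
    [NeZero n] {K : Type*} [Field K] [Finite K]
    (σ : Equiv.Perm ((ZMod n)ˣ × Kˣ))
    (hσ : ∀ x : (ZMod n)ˣ × Kˣ,
      ((σ x).1 : ZMod n) = (p : ZMod n) ^ ν * (x.1 : ZMod n) ∧
        ((σ x).2 : K) ^ (p ^ ν) = (x.2 : K)) :
    Nat.card {x | (Function.minimalPeriod σ x : ℝ) < f / (2 * ν)} ≤ n * p ^ (f / 2 + 1) := by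
  have hsub : {x | (Function.minimalPeriod σ x : ℝ) < f / (2 * ν)} ⊆
      (Set.univ : Set (ZMod n)ˣ) ×ˢ {a : Kˣ | ∃ j, 1 ≤ j ∧ j ≤ f / 2 ∧ a ^ p ^ j = a} := by
    intro x hx
    refine ⟨trivial, ν * Function.minimalPeriod σ x, ?_, ?_, ?_⟩
    · exact Nat.mul_pos hν (Function.minimalPeriod_pos_of_mem_periodicPts
        (Function.Injective.mem_periodicPts σ.injective x))
    · rw [Set.mem_ofPred_eq, lt_div_iff₀ (by positivity)] at hx
      have : Function.minimalPeriod σ x * (2 * ν) < f := by exact_mod_cast hx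
      rw [Nat.le_div_iff_mul_le two_pos]
      linarith
    · have h := (frobenius_twist_iterate_spec σ hσ (Function.minimalPeriod σ x) x).2
      rwa [Function.iterate_minimalPeriod] at h
  refine (Nat.card_mono (Set.toFinite _) hsub).trans ?_
  rw [Nat.card_coe_set_eq, Set.ncard_prod, Set.ncard_univ]
  refine Nat.mul_le_mul ?_ ?_
  · rw [Nat.card_eq_fintype_card, ZMod.card_units_eq_totient]
    exact Nat.totient_le n
  · rw [← Nat.card_coe_set_eq]
    exact card_units_exists_pow_pow_eq_self_le p (f / 2) hp

theorem mul_pow_half_succ_le {p : ℕ} (hp : 2 ≤ p) (f : ℕ) :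
    f * p ^ (f / 2 + 1) ≤ 2 * p * p ^ f := by
  have h1 : f - f / 2 < p ^ (f - f / 2) := Nat.lt_pow_self (by omega)
  have h2 : p ^ f = p ^ (f / 2) * p ^ (f - f / 2) := by
    rw [← pow_add]; congr 1; omega
  calc f * p ^ (f / 2 + 1) ≤ (2 * p ^ (f - f / 2)) * p ^ (f / 2 + 1) :=
        Nat.mul_le_mul_right _ (by omega)
    _ = 2 * p * p ^ f := by rw [h2]; ring

theorem one_le_log_log {x : ℝ} (hx : 16 ≤ x) : 1 ≤ Real.log (Real.log x) := by
  have h16 : Real.exp 1 ≤ Real.log x := by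
    have h : Real.log 16 = 4 * Real.log 2 := by
      rw [show (16 : ℝ) = 2 ^ 4 by norm_num, Real.log_pow]; norm_num
    have := Real.log_le_log (by norm_num) hx
    have := Real.log_two_gt_d9
    have := Real.exp_one_lt_d9
    linarith
  exact (Real.le_log_iff_exp_le ((Real.exp_pos 1).trans_le h16)).mpr h16


/-- Let `p` be prime, `r = p^ν`, and `n ≥ 1` coprime to `p`.  There is a
constant `C > 0` depending only on `r` and `n` such that for every power `q = p^f` of `p`
with `q ≥ 16`, the sum over all orbits `o` on `S^×_{n,q} = (ℤ/nℤ)^× × F_q^×` of the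
permutation `σ(i, α) = (r·i, α^{1/r})` of `log |o|` is at most
`C·q·(log log q)/(log q)`.  Orbits are the classes of the quotient by the equivalence
relation generated by `x ∼ σ(x)`, and `|o|` is the number of elements in the class `o`. -/
theorem statement18 (p ν n : ℕ) [Fact p.Prime] (hν : 1 ≤ ν) (hn : 1 ≤ n)
    (hpn : Nat.Coprime p n) :
    ∃ C : ℝ, 0 < C ∧
      ∀ f : ℕ, 1 ≤ f → 16 ≤ p ^ f →
        ∀ σ : Equiv.Perm ((ZMod n)ˣ × (GaloisField p f)ˣ),
          (∀ x : (ZMod n)ˣ × (GaloisField p f)ˣ,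
            ((σ x).1 : ZMod n) = (p : ZMod n) ^ ν * (x.1 : ZMod n) ∧
            ((σ x).2 : GaloisField p f) ^ (p ^ ν) = (x.2 : GaloisField p f)) →
          (∑ᶠ o : Quot (fun a b => σ a = b),
              Real.log (Nat.card {x | Quot.mk (fun a b => σ a = b) x = o}))
            ≤ C * ((p : ℝ) ^ f) * Real.log (Real.log ((p : ℝ) ^ f))
                / Real.log ((p : ℝ) ^ f) := by
  have hp2 : 2 ≤ p := (Fact.out : p.Prime).two_le
  have hpR : (2 : ℝ) ≤ p := by exact_mod_cast hp2
  have hnR : (1 : ℝ) ≤ n := by exact_mod_cast hn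
  have hνR : (1 : ℝ) ≤ ν := by exact_mod_cast hν
  have hlogp : 0 < Real.log p := Real.log_pos (by linarith)
  have hlogn : 0 ≤ Real.log (2 * n) := Real.log_nonneg (by linarith)
  have : NeZero n := ⟨by omega⟩
  refine ⟨(Real.log (2 * n) + 1) * (n * (2 * ν + 2 * p)) * Real.log p, by positivity, ?_⟩
  intro f hf hq σ hσ
  have hfR : (1 : ℝ) ≤ f := by exact_mod_cast hf
  have hqR : (16 : ℝ) ≤ (p : ℝ) ^ f := by exact_mod_cast hq
  have hK : Nat.card (GaloisField p f) = p ^ f := GaloisField.card p f (by omega)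
  have : Finite (GaloisField p f) := Nat.finite_of_card_ne_zero (by rw [hK]; positivity)
  have hφ : 0 < n.totient := Nat.totient_pos.mpr hn
  refine (finsum_log_card_quot_le σ (n.totient * f) (Nat.mul_pos hφ hf)
    (frobenius_twist_iterate_eq_self hpn hK σ hσ) (f / (2 * ν)) (by positivity)).trans ?_
  have hll := one_le_log_log hqR
  have hlogq : Real.log ((p : ℝ) ^ f) = f * Real.log p := Real.log_pow _ _
  have hN : Real.log ((n.totient * f : ℕ) : ℝ)
      ≤ (Real.log (2 * n) + 1) * Real.log (Real.log ((p : ℝ) ^ f)) := by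
    have hl2 : (1 : ℝ) / 2 ≤ Real.log p := by
      have := Real.log_le_log (by norm_num) hpR
      have := Real.log_two_gt_d9
      linarith
    have hle : ((n.totient * f : ℕ) : ℝ) ≤ (2 * n) * Real.log ((p : ℝ) ^ f) := by
      have h1 : (n.totient : ℝ) ≤ n := by exact_mod_cast Nat.totient_le n
      rw [hlogq]
      push_cast
      calc (n.totient : ℝ) * f ≤ n * f * 1 := by rw [mul_one]; gcongr
        _ ≤ n * f * (2 * Real.log p) := by gcongr; linarith
        _ = _ := by ring
    have hpos : 0 < Real.log ((p : ℝ) ^ f) := by rw [hlogq]; positivity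
    have := Real.log_le_log (by exact_mod_cast Nat.mul_pos hφ hf) hle
    rw [Real.log_mul (by positivity) hpos.ne'] at this
    nlinarith
  have hcard : Nat.card ((ZMod n)ˣ × (GaloisField p f)ˣ) ≤ n * p ^ f := by
    rw [Nat.card_prod, Nat.card_eq_fintype_card (α := (ZMod n)ˣ), ZMod.card_units_eq_totient,
      ← hK]
    exact Nat.mul_le_mul (Nat.totient_le n)
      (Nat.card_le_card_of_injective _ Units.val_injective)
  have hsum : (Nat.card ((ZMod n)ˣ × (GaloisField p f)ˣ) : ℝ) / (f / (2 * ν))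
      + Nat.card {x | (Function.minimalPeriod σ x : ℝ) < f / (2 * ν)}
      ≤ n * (2 * ν + 2 * p) * (p : ℝ) ^ f / f := by
    have hc : (Nat.card ((ZMod n)ˣ × (GaloisField p f)ˣ) : ℝ) ≤ n * (p : ℝ) ^ f := by
      exact_mod_cast hcard
    have hb : (Nat.card {x | (Function.minimalPeriod σ x : ℝ) < f / (2 * ν)} : ℝ)
        ≤ n * (p : ℝ) ^ (f / 2 + 1) := by
      exact_mod_cast card_frobenius_twist_minimalPeriod_lt_le hp2 hν σ hσ
    have hh : (f : ℝ) * (p : ℝ) ^ (f / 2 + 1) ≤ 2 * p * (p : ℝ) ^ f := by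
      exact_mod_cast mul_pow_half_succ_le hp2 f
    rw [← mul_div_mul_left _ _ (show (2 * ν : ℝ) ≠ 0 by positivity),
      mul_div_cancel₀ _ (by positivity), le_div_iff₀ (by positivity), add_mul,
      div_mul_cancel₀ _ (by positivity)]
    nlinarith [mul_le_mul_of_nonneg_left hc (show (0 : ℝ) ≤ 2 * ν by positivity),
      mul_le_mul_of_nonneg_right hb (show (0 : ℝ) ≤ f by positivity),
      mul_le_mul_of_nonneg_left hh (show (0 : ℝ) ≤ n by positivity)]
  refine (mul_le_mul hN hsum (by positivity) (by positivity)).trans (le_of_eq ?_)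
  generalize Real.log (Real.log ((p : ℝ) ^ f)) = L
  rw [hlogq]
  field_simp
end
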